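/- Let K be a field of characteristic zero and let n ≥ 1 and r ≥ 1 be integers. Then there exists a nonzero polynomial G in 4n variables over K such that for every tuple (v_1,…,v_n) of nonzero vectors in K^4 with G(v_1,…,v_n) ≠ 0, the ideal I = ⋂_{j=1}^n m_{v_j} of the corresponding simple points in P^3 satisfies I^{(3r-2)} ⊆ M^{2r-2} · I^r. -/

import Mathlib

open MvPolynomial Filter

noncomputable section

/-- The ideal of a point of `ℙ³` represented by a nonzero vector `v ∈ K⁴`:
the ideal generated by all linear forms vanishing at `v`. -/
def pointIdeal (K : Type) [Field K] (v : Fin 4 → K) : Ideal (MvPolynomial (Fin 4) K) :=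
  Ideal.span {f | f.IsHomogeneous 1 ∧ eval v f = 0}

/-- The irrelevant maximal ideal `M = (x₀, x₁, x₂, x₃)`. -/
def irrIdeal (K : Type) [Field K] : Ideal (MvPolynomial (Fin 4) K) :=
  Ideal.span (Set.range X)

section Syzygy

/-- Exponent vectors of total degree `δ`. -/
abbrev Expo (σ : Type) (δ : ℕ) : Type := {α : σ →₀ ℕ // α.degree = δ}

variable {σ K : Type} [Field K] {δ : ℕ}

instance [Finite σ] : Finite (Expo σ δ) :=
  (Finsupp.finite_of_degree_eq δ).to_subtype

variable [DecidableEq (Expo σ δ)]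

/-- Two monomial multiples `x^γ x^α = x^γ' x^β` are connected by elementary syzygies. -/
lemma good_of_monomial_pair {s : ℕ}
    (Good : (Expo σ δ → MvPolynomial σ K) → Prop)
    (zero : Good 0) (add : ∀ a b, Good a → Good b → Good (a + b))
    (elem : ∀ (α β : Expo σ δ) (i j : σ),
      α.1 + Finsupp.single i 1 = β.1 + Finsupp.single j 1 →
      ∀ c ∈ idealOfVars σ K ^ s, Good (Pi.single α (X i * c) - Pi.single β (X j * c)))
    (c : K) (β : Expo σ δ) (γ' : σ →₀ ℕ) (D : ℕ) :
    ∀ (α : Expo σ δ) (γ : σ →₀ ℕ), (β.1 - α.1).degree = D →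
      α.1 + γ = β.1 + γ' → s + 1 ≤ γ.degree →
      Good (Pi.single α (monomial γ c) - Pi.single β (monomial γ' c)) := by
  induction D with
  | zero =>
    intro α γ hD h hs
    have h1 : β.1 ≤ α.1 := by
      rw [Finsupp.degree_eq_zero_iff] at hD
      exact tsub_eq_zero_iff_le.mp hD
    obtain ⟨t, ht⟩ := exists_add_of_le h1
    have h2 : t.degree = 0 := by
      have := congrArg Finsupp.degree ht
      rw [map_add, α.2, β.2] at this
      omega
    rw [Finsupp.degree_eq_zero_iff] at h2
    have h3 : α = β := Subtype.ext (by simpa [h2] using ht)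
    subst h3
    have h4 : γ = γ' := add_left_cancel h
    subst h4
    simpa using zero
  | succ D ih =>
    intro α γ hD h hs
    classical
    obtain ⟨i, hi⟩ : ∃ i, α.1 i < β.1 i := by
      by_contra! hc
      have : β.1 - α.1 = 0 := tsub_eq_zero_iff_le.mpr (fun i => hc i)
      simp [this] at hD
    obtain ⟨j, hj⟩ : ∃ j, β.1 j < α.1 j := by
      by_contra! hc
      obtain ⟨t, ht⟩ := exists_add_of_le (show α.1 ≤ β.1 from fun i => hc i)
      have h2 := congrArg Finsupp.degree ht
      rw [map_add, α.2, β.2] at h2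
      rw [ht, add_tsub_cancel_left] at hD
      omega
    have hij : i ≠ j := by rintro rfl; omega
    have hγi : γ i = β.1 i + γ' i - α.1 i := by
      have := DFunLike.congr_fun h i
      simp only [Finsupp.add_apply] at this
      omega
    obtain ⟨γ₀, hγ₀⟩ := exists_add_of_le (show Finsupp.single i 1 ≤ γ by
      rw [Finsupp.single_le_iff]; omega)
    obtain ⟨α₀, hα₀⟩ := exists_add_of_le (show Finsupp.single j 1 ≤ α.1 by
      rw [Finsupp.single_le_iff]; omega)
    have hαd : α₀.degree + 1 = δ := by
      have := congrArg Finsupp.degree hα₀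
      rw [map_add, α.2, Finsupp.degree_single] at this
      omega
    let α' : Expo σ δ := ⟨α₀ + Finsupp.single i 1, by
      rw [map_add, Finsupp.degree_single]; exact hαd⟩
    have hsum : α'.1 + (γ₀ + Finsupp.single j 1) = β.1 + γ' := by
      rw [← h, hα₀, hγ₀]
      simp only [α']
      abel
    have hdeg : (β.1 - α'.1).degree = D := by
      have : β.1 - α.1 = (β.1 - α'.1) + Finsupp.single i 1 := by
        ext l
        have h1 := DFunLike.congr_fun hα₀ l
        simp only [Finsupp.add_apply, Finsupp.tsub_apply, α', Finsupp.single_apply] at h1 ⊢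
        by_cases hl : i = l
        · subst hl
          simp [hij.symm] at h1 ⊢
          omega
        · by_cases hl' : j = l
          · subst hl'
            simp [hl] at h1 ⊢
            omega
          · simp [hl, hl'] at h1 ⊢
            omega
      rw [this, map_add, Finsupp.degree_single] at hD
      omega
    have hγd : s + 1 ≤ γ₀.degree + 1 := by
      have := congrArg Finsupp.degree hγ₀
      rw [map_add, Finsupp.degree_single] at this
      omega
    have key := ih α' _ hdeg hsum (by rw [map_add, Finsupp.degree_single]; exact hγd)
    have el := elem α α' i j (by rw [hα₀]; simp only [α']; abel) (monomial γ₀ c) (by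
      rcases eq_or_ne c 0 with rfl | hc
      · simp
      · rw [monomial_mem_pow_idealOfVars_iff _ _ hc]; omega)
    have := add _ _ el key
    have e1 : (X i * monomial γ₀ c : MvPolynomial σ K) = monomial γ c := by
      rw [hγ₀, X, monomial_mul, one_mul]
    have e2 : (X j * monomial γ₀ c : MvPolynomial σ K) = monomial (γ₀ + Finsupp.single j 1) c := by
      rw [add_comm, X, monomial_mul, one_mul]
    rw [e1, e2, sub_add_sub_cancel] at this
    exact this

/-- Syzygies of the monomials of degree `δ` with coefficients of order at least `s + 1` are sums
of elementary ones with coefficients of order at least `s`. -/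
lemma good_of_monomial_syzygy [Fintype (Expo σ δ)] {s : ℕ}
    (Good : (Expo σ δ → MvPolynomial σ K) → Prop)
    (zero : Good 0) (add : ∀ a b, Good a → Good b → Good (a + b))
    (elem : ∀ (α β : Expo σ δ) (i j : σ),
      α.1 + Finsupp.single i 1 = β.1 + Finsupp.single j 1 →
      ∀ c ∈ idealOfVars σ K ^ s, Good (Pi.single α (X i * c) - Pi.single β (X j * c)))
    (a : Expo σ δ → MvPolynomial σ K)
    (ha : ∀ α, a α ∈ idealOfVars σ K ^ (s + 1))
    (hsum : ∑ α, monomial α.1 1 * a α = 0) : Good a := by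
  classical
  have good_sum : ∀ {ι : Type} (t : Finset ι) (f : ι → Expo σ δ → MvPolynomial σ K), (∀ x ∈ t, Good (f x)) → Good (∑ x ∈ t, f x) := by
    intro ι t f hf
    exact Finset.sum_induction f Good add zero hf
  let T : Finset (σ →₀ ℕ) := Finset.univ.biUnion fun α => (a α).support.image (α.1 + ·)
  let b : (σ →₀ ℕ) → Expo σ δ → MvPolynomial σ K := fun ρ α =>
    if α.1 ≤ ρ then monomial (ρ - α.1) (coeff (ρ - α.1) (a α)) else 0
  have hab : a = ∑ ρ ∈ T, b ρ := by
    funext α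
    rw [Finset.sum_apply]
    ext γ
    rw [coeff_sum]
    have h1 : ∀ ρ ∈ T, ρ ≠ α.1 + γ → coeff γ (b ρ α) = 0 := by
      intro ρ _ hne
      simp only [b]
      split_ifs with hle
      · rw [coeff_monomial, if_neg]
        rintro rfl
        exact hne (add_tsub_cancel_of_le hle).symm
      · simp
    by_cases hT : α.1 + γ ∈ T
    · rw [Finset.sum_eq_single_of_mem _ hT h1]
      simp [b]
    · rw [Finset.sum_eq_zero (fun ρ hρ => h1 ρ hρ (fun h => hT (h ▸ hρ)))]
      by_contra hne
      exact hT (Finset.mem_biUnion.mpr ⟨α, Finset.mem_univ _, Finset.mem_image.mpr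
        ⟨γ, by rwa [mem_support_iff], rfl⟩⟩)
  rw [hab]
  refine good_sum _ _ fun ρ _ => ?_
  by_cases hρ : ρ.degree < δ + (s + 1)
  · have : b ρ = 0 := by
      funext α
      simp only [b, Pi.zero_apply]
      split_ifs with hle
      · rw [(mem_pow_idealOfVars_iff' _ _).mp (ha α), map_zero]
        obtain ⟨t, rfl⟩ := exists_add_of_le hle
        rw [map_add, α.2] at hρ
        rw [add_tsub_cancel_left]
        omega
      · rfl
    rw [this]
    exact zero
  · obtain ⟨α₀, hα₀, hd⟩ := Finsupp.exists_le_degree_eq ρ δ (by omega)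
    let α₁ : Expo σ δ := ⟨α₀, hd⟩
    let cf : Expo σ δ → K := fun α =>
      if α.1 ≤ ρ then coeff (ρ - α.1) (a α) else 0
    have hcf : ∑ α, cf α = 0 := by
      have := congrArg (coeff ρ) hsum
      rw [coeff_sum, coeff_zero] at this
      rw [← this]
      refine Finset.sum_congr rfl fun α _ => ?_
      rw [coeff_monomial_mul']
      simp [cf]
    have : b ρ = ∑ α : Expo σ δ, ((Pi.single α (monomial (ρ - α.1) (cf α)) -
        Pi.single α₁ (monomial (ρ - α₁.1) (cf α)) : Expo σ δ → MvPolynomial σ K)) := by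
      rw [Finset.sum_sub_distrib]
      have : ∑ α : Expo σ δ, (Pi.single α₁ (monomial (ρ - α₁.1) (cf α)) :
          Expo σ δ → MvPolynomial σ K) = 0 := by
        funext x
        rw [Finset.sum_apply]
        rcases eq_or_ne x α₁ with rfl | hx
        · simp only [Pi.single_eq_same]
          rw [← map_sum, hcf, map_zero, Pi.zero_apply]
        · simp [Pi.single_eq_of_ne hx]
      rw [this, sub_zero]
      rw [Finset.univ_sum_single]
      funext α
      simp only [b, cf]
      split_ifs <;> simp
    rw [this]
    refine good_sum _ _ fun α _ => ?_
    by_cases hle : α.1 ≤ ρ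
    · refine good_of_monomial_pair Good zero add elem (cf α) α₁ _ _ α _ rfl ?_ ?_
      · rw [add_tsub_cancel_of_le hle, add_tsub_cancel_of_le hα₀]
      · obtain ⟨t, rfl⟩ := exists_add_of_le hle
        rw [map_add, α.2] at hρ
        rw [add_tsub_cancel_left]
        omega
    · simpa [cf, hle] using zero

end Syzygy

section Descent

variable {K : Type} [Field K]

/-- Reduction modulo the first variable. -/
def dropZero : MvPolynomial (Fin 4) K →ₐ[K] MvPolynomial (Fin 3) K :=
  aeval (Fin.cons 0 X)

@[simp] lemma dropZero_X_zero : dropZero (X 0 : MvPolynomial (Fin 4) K) = 0 := by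
  simp [dropZero]

@[simp] lemma dropZero_X_succ (i : Fin 3) :
    dropZero (X i.succ : MvPolynomial (Fin 4) K) = X i := by
  simp [dropZero]

@[simp] lemma dropZero_rename (f : MvPolynomial (Fin 3) K) :
    dropZero (rename Fin.succ f) = f := by
  have : (dropZero.comp (rename Fin.succ)) = AlgHom.id K (MvPolynomial (Fin 3) K) := by
    ext i : 1
    simp
  exact DFunLike.congr_fun this f

lemma dropZero_surjective : Function.Surjective (dropZero (K := K)) :=
  fun f => ⟨_, dropZero_rename f⟩

lemma X_dvd_sub_rename_dropZero (f : MvPolynomial (Fin 4) K) :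
    X 0 ∣ f - rename Fin.succ (dropZero f) := by
  induction f using MvPolynomial.induction_on with
  | C a =>
    have : dropZero (C a : MvPolynomial (Fin 4) K) = C a := dropZero.commutes a
    simp [this]
  | add p q hp hq =>
    rw [map_add, map_add, add_sub_add_comm]
    exact dvd_add hp hq
  | mul_X p i hp =>
    refine Fin.cases ?_ (fun j => ?_) i
    · simp
    · rw [map_mul, dropZero_X_succ, map_mul, rename_X, ← sub_mul]
      exact dvd_mul_of_dvd_left hp _

lemma X_dvd_of_dropZero_eq_zero {f : MvPolynomial (Fin 4) K} (hf : dropZero f = 0) :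
    X 0 ∣ f := by
  simpa [hf] using X_dvd_sub_rename_dropZero f

lemma irrIdeal_eq : irrIdeal K = idealOfVars (Fin 4) K := rfl

lemma map_dropZero_irrIdeal_pow (k : ℕ) :
    (irrIdeal K ^ k).map (dropZero (K := K)) = idealOfVars (Fin 3) K ^ k := by
  rw [Ideal.map_pow]
  congr 1
  rw [irrIdeal, idealOfVars, Ideal.map_span]
  apply le_antisymm
  · rw [Ideal.span_le]
    rintro _ ⟨_, ⟨i, rfl⟩, rfl⟩
    refine Fin.cases ?_ (fun j => ?_) i
    · simp
    · exact Ideal.subset_span ⟨j, by simp⟩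
  · rw [Ideal.span_le]
    rintro _ ⟨i, rfl⟩
    exact Ideal.subset_span ⟨X i.succ, ⟨_, rfl⟩, by simp⟩

lemma mem_irrIdeal_pow_of_X_mul {k : ℕ} {F : MvPolynomial (Fin 4) K}
    (h : X 0 * F ∈ irrIdeal K ^ (k + 1)) : F ∈ irrIdeal K ^ k := by
  rw [irrIdeal_eq, mem_pow_idealOfVars_iff'] at h ⊢
  intro x hx
  rw [← coeff_X_mul x 0]
  apply h
  rw [map_add, Finsupp.degree_single]
  omega

/-- Cancelling `x₀` from `M ^ (k + 1) * P ^ r`, for an ideal `P` whose reduction modulo `x₀` is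
a power of the maximal ideal and whose syzygies lift. -/
theorem mem_of_X_mul_mem {δ : ℕ} {P N : Ideal (MvPolynomial (Fin 4) K)}
    (g : Expo (Fin 3) δ → MvPolynomial (Fin 4) K) (hgP : ∀ α, g α ∈ P)
    (hg : ∀ α, dropZero (g α) = monomial α.1 1)
    (hPδ : P ≤ irrIdeal K ^ δ)
    (hP : P ≤ Ideal.span (Set.range g) ⊔ Ideal.span {X 0} * N)
    (hN : irrIdeal K * N ≤ P)
    (hsyz : ∀ (α β : Expo (Fin 3) δ) (i j : Fin 3),
      α.1 + Finsupp.single i 1 = β.1 + Finsupp.single j 1 →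
      ∃ g' ∈ P, (X i.succ : MvPolynomial (Fin 4) K) * g α -
        (X j.succ : MvPolynomial (Fin 4) K) * g β = X 0 * g') (r : ℕ) :
    ∀ (k : ℕ) (F : MvPolynomial (Fin 4) K), X 0 * F ∈ irrIdeal K ^ (k + 1) * P ^ r →
      F ∈ irrIdeal K ^ k * P ^ r := by
  classical
  have hX (i : Fin 4) : (X i : MvPolynomial (Fin 4) K) ∈ irrIdeal K :=
    Ideal.subset_span ⟨i, rfl⟩
  induction r with
  | zero =>
    intro k F hF
    rw [pow_zero, Ideal.one_eq_top, Ideal.mul_top] at hF ⊢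
    exact mem_irrIdeal_pow_of_X_mul hF
  | succ r ih =>
    intro k F hF
    have : Fintype (Expo (Fin 3) δ) := Fintype.ofFinite _
    have h1 : irrIdeal K ^ (k + 1) * P ^ (r + 1) ≤
        (irrIdeal K ^ (k + 1) * P ^ r) * Ideal.span (Set.range g) ⊔
          Ideal.span {X 0} * (irrIdeal K ^ k * P ^ (r + 1)) := by
      rw [pow_succ P r, ← mul_assoc]
      refine (Ideal.mul_mono_right hP).trans ?_
      rw [Ideal.mul_sup]
      refine sup_le_sup le_rfl ?_
      calc irrIdeal K ^ (k + 1) * P ^ r * (Ideal.span {X 0} * N)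
          = Ideal.span {X 0} * (irrIdeal K ^ k * P ^ r * (irrIdeal K * N)) := by ring
        _ ≤ Ideal.span {X 0} * (irrIdeal K ^ k * P ^ r * P) :=
            Ideal.mul_mono_right (Ideal.mul_mono_right hN)
        _ = _ := by ring
    obtain ⟨y, hy, z, hz, hyz⟩ := Submodule.mem_sup.mp (h1 hF)
    obtain ⟨b, hb, rfl⟩ := Ideal.mem_span_singleton_mul.mp hz
    obtain ⟨a', ha', hay⟩ := (Submodule.mem_ideal_smul_span_iff_exists_sum
      (irrIdeal K ^ (k + 1) * P ^ r) g y).mp hy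
    obtain ⟨a, ha, rfl⟩ : ∃ a : Expo (Fin 3) δ → MvPolynomial (Fin 4) K,
        (∀ α, a α ∈ irrIdeal K ^ (k + 1) * P ^ r) ∧ ∑ α, g α * a α = y := by
      refine ⟨a', ha', ?_⟩
      rw [← hay, Finsupp.sum_fintype]
      · simp [mul_comm]
      · simp
    -- the tuples of reductions that lift
    let Good : (Expo (Fin 3) δ → MvPolynomial (Fin 3) K) → Prop := fun c =>
      ∃ C : Expo (Fin 3) δ → MvPolynomial (Fin 4) K,
        (∀ α, C α ∈ irrIdeal K ^ (k + 1) * P ^ r) ∧ (∀ α, dropZero (C α) = c α) ∧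
        ∃ t ∈ irrIdeal K ^ k * P ^ (r + 1), ∑ α, g α * C α = X 0 * t
    have hPr : P ^ r ≤ irrIdeal K ^ (δ * r) := by
      rw [pow_mul]; exact Ideal.pow_right_mono hPδ r
    have hmap : idealOfVars (Fin 3) K ^ (k + δ * r) ≤
        (irrIdeal K ^ k * P ^ r).map (dropZero (K := K)) := by
      rw [Ideal.map_mul, map_dropZero_irrIdeal_pow, pow_add, Ideal.map_pow, pow_mul]
      refine Ideal.mul_mono_right (Ideal.pow_right_mono ?_ r)
      rw [pow_idealOfVars_eq_span, Ideal.span_le]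
      rintro _ ⟨x, hx, rfl⟩
      have := Ideal.mem_map_of_mem (dropZero (K := K)) (hgP ⟨x, hx⟩)
      rw [hg] at this
      exact this
    have hgood : Good (fun α => dropZero (a α)) := by
      refine good_of_monomial_syzygy (s := k + δ * r) Good ?_ ?_ ?_ _ ?_ ?_
      · exact ⟨0, by simp, by simp, 0, by simp, by simp⟩
      · rintro c₁ c₂ ⟨C₁, h₁, h₁', t₁, ht₁, e₁⟩ ⟨C₂, h₂, h₂', t₂, ht₂, e₂⟩
        refine ⟨C₁ + C₂, fun α => add_mem (h₁ α) (h₂ α), fun α => ?_, t₁ + t₂,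
          add_mem ht₁ ht₂, ?_⟩
        · simp [h₁', h₂']
        · simp only [Pi.add_apply, mul_add, Finset.sum_add_distrib, e₁, e₂]
      · intro α β i j hij c hc
        obtain ⟨C, hC, rfl⟩ := (Ideal.mem_map_iff_of_surjective _ dropZero_surjective).mp
          (hmap hc)
        obtain ⟨g', hg', e⟩ := hsyz α β i j hij
        have hC' (i : Fin 4) : X i * C ∈ irrIdeal K ^ (k + 1) * P ^ r := by
          rw [pow_succ', mul_assoc]
          exact Ideal.mul_mem_mul (hX i) hC
        have hsingle (α : Expo (Fin 3) δ) (i : Fin 4) (x : Expo (Fin 3) δ) :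
            (Pi.single α (X i * C) : Expo (Fin 3) δ → MvPolynomial (Fin 4) K) x ∈
              irrIdeal K ^ (k + 1) * P ^ r := by
          rw [Pi.single_apply]
          split_ifs
          · exact hC' i
          · exact zero_mem _
        refine ⟨Pi.single α ((X i.succ : MvPolynomial (Fin 4) K) * C) -
          Pi.single β ((X j.succ : MvPolynomial (Fin 4) K) * C), fun x => ?_, fun x => ?_,
          C * g', ?_, ?_⟩
        · exact sub_mem (hsingle _ _ _) (hsingle _ _ _)
        · simp only [Pi.sub_apply, map_sub, Pi.single_apply]
          congr 1 <;> split_ifs <;> simp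
        · rw [pow_succ P, ← mul_assoc]
          exact Ideal.mul_mem_mul hC hg'
        · simp only [Pi.sub_apply, mul_sub, Finset.sum_sub_distrib, Pi.single_apply, mul_ite,
            mul_zero, Finset.sum_ite_eq', Finset.mem_univ, if_true]
          linear_combination C * e
      · intro α
        have h2 : irrIdeal K ^ (k + 1) * P ^ r ≤ irrIdeal K ^ (k + δ * r + 1) := by
          rw [show k + δ * r + 1 = k + 1 + δ * r by ring, pow_add _ (k + 1)]
          exact Ideal.mul_mono_right hPr
        rw [← map_dropZero_irrIdeal_pow]
        exact Ideal.mem_map_of_mem _ (h2 (ha α))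
      · have := congrArg dropZero hyz
        simpa [hg] using this
    obtain ⟨C, hC, hC', t, ht, e⟩ := hgood
    have hdiv (α) : ∃ q ∈ irrIdeal K ^ k * P ^ r, a α - C α = X 0 * q := by
      obtain ⟨q, hq⟩ := X_dvd_of_dropZero_eq_zero (f := a α - C α) (by rw [map_sub, hC', sub_self])
      exact ⟨q, ih k q (hq ▸ sub_mem (ha α) (hC α)), hq⟩
    choose q hq hq' using hdiv
    have hF' : F = b + t + ∑ α, g α * q α := by
      apply mul_left_cancel₀ (X_ne_zero (R := K) (0 : Fin 4))
      rw [← hyz]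
      have : ∑ α, g α * a α = ∑ α, g α * C α + X 0 * ∑ α, g α * q α := by
        rw [Finset.mul_sum, ← Finset.sum_add_distrib]
        refine Finset.sum_congr rfl fun α _ => ?_
        linear_combination g α * hq' α
      rw [this, e]
      ring
    rw [hF']
    refine add_mem (add_mem hb ht) (sum_mem fun α _ => ?_)
    rw [pow_succ' P, mul_left_comm]
    exact Ideal.mul_mem_mul (hgP α) (hq α)

end Descent

section Points

variable {K : Type} [Field K]

lemma homogeneousComponent_mul_of_isHomogeneous {σ : Type} {b : MvPolynomial σ K} {D : ℕ}
    (hb : b.IsHomogeneous D) (a : MvPolynomial σ K) (s : ℕ) :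
    homogeneousComponent (s + D) (a * b) = homogeneousComponent s a * b := by
  let _ := gradedAlgebra (σ := σ) (R := K)
  have h := DirectSum.coe_decompose_mul_of_right_mem_of_le (homogeneousSubmodule σ K) (a := a)
    (b := b) (i := D) (n := s + D) hb (by omega)
  rw [Nat.add_sub_cancel] at h
  have e (p : MvPolynomial σ K) (i : ℕ) :
      (DirectSum.decompose (homogeneousSubmodule σ K) p i : MvPolynomial σ K) =
        homogeneousComponent i p := decomposition.decompose'_apply p i
  rwa [e, e] at h

lemma isHomogeneous_of_X_mul {b : MvPolynomial (Fin 4) K} {n : ℕ}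
    (h : (X 0 * b).IsHomogeneous (n + 1)) : b.IsHomogeneous n := by
  intro x hx
  rw [← coeff_X_mul x 0] at hx
  have := h hx
  rw [map_add] at this
  simp only [Finsupp.weight_single, Pi.one_apply, smul_eq_mul, mul_one] at this
  omega

lemma isHomogeneous_mem_irrIdeal_pow {f : MvPolynomial (Fin 4) K} {n : ℕ}
    (hf : f.IsHomogeneous n) : f ∈ irrIdeal K ^ n := by
  rw [irrIdeal_eq, mem_pow_idealOfVars_iff]
  intro x hx
  exact (hf.degree_eq_sum_deg_support hx).le.trans_eq (by simp [Finsupp.degree_apply])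

section

attribute [local instance] MvPolynomial.gradedAlgebra

lemma pointIdeal_isHomogeneous (v : Fin 4 → K) :
    (pointIdeal K v).IsHomogeneous (homogeneousSubmodule (Fin 4) K) :=
  Ideal.homogeneous_span _ _ fun _ hx => ⟨1, hx.1⟩

lemma homogeneousComponent_mem_iInf_pow {n m : ℕ} {v : Fin n → Fin 4 → K}
    {F : MvPolynomial (Fin 4) K} (hF : F ∈ ⨅ j, pointIdeal K (v j) ^ m) (t : ℕ) :
    homogeneousComponent t F ∈ ⨅ j, pointIdeal K (v j) ^ m := by
  refine homogeneousComponent_mem_of_mem (Ideal.IsHomogeneous.iInf fun j => ?_) hF t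
  have := pointIdeal_isHomogeneous (v j)
  clear hF
  induction m with
  | zero => rw [pow_zero, Ideal.one_eq_top]; exact Ideal.IsHomogeneous.top _
  | succ m ih => rw [pow_succ]; exact ih.mul this

end

/-- The ideal generated by the forms of degree `d` vanishing at the points `v j`. -/
def formsIdeal {n : ℕ} (v : Fin n → Fin 4 → K) (d : ℕ) : Ideal (MvPolynomial (Fin 4) K) :=
  Ideal.span {f | f.IsHomogeneous d ∧ ∀ j, eval (v j) f = 0}

lemma aeval_smul_X_zero {F : MvPolynomial (Fin 4) K} {d : ℕ} (hF : F.IsHomogeneous d)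
    (c : Fin 4 → K) :
    aeval (fun i => C (c i) * X 0 : Fin 4 → MvPolynomial (Fin 4) K) F =
      C (eval c F) * X 0 ^ d := by
  rw [aeval_def, eval₂_eq', eval_eq', map_sum, Finset.sum_mul]
  refine Finset.sum_congr rfl fun x hx => ?_
  have hd : ∑ i, x i = d := by
    rw [← Finsupp.degree_eq_sum, Finsupp.degree_eq_weight_one]
    exact hF (mem_support_iff.mp hx)
  simp_rw [mul_pow, Finset.prod_mul_distrib, Finset.prod_pow_eq_pow_sum, hd, map_mul, map_prod,
    map_pow, algebraMap_eq, mul_assoc]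

lemma sub_aeval_mem_pointIdeal {v : Fin 4 → K} (hv : v 0 ≠ 0) (F : MvPolynomial (Fin 4) K) :
    F - aeval (fun i => C (v i / v 0) * X 0 : Fin 4 → MvPolynomial (Fin 4) K) F ∈
      pointIdeal K v := by
  rw [← Ideal.Quotient.eq]
  have : (Ideal.Quotient.mkₐ K (pointIdeal K v)) = (Ideal.Quotient.mkₐ K (pointIdeal K v)).comp
      (aeval (fun i => C (v i / v 0) * X 0 : Fin 4 → MvPolynomial (Fin 4) K)) := by
    ext i
    simp only [AlgHom.comp_apply, aeval_X, Ideal.Quotient.mkₐ_eq_mk]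
    rw [Ideal.Quotient.eq]
    refine Ideal.subset_span ⟨(isHomogeneous_X _ _).sub (isHomogeneous_C_mul_X _ _), ?_⟩
    simp [div_mul_cancel₀ _ hv]
  exact DFunLike.congr_fun this F

lemma mem_pointIdeal_of_isHomogeneous {v : Fin 4 → K} (hv : v 0 ≠ 0)
    {F : MvPolynomial (Fin 4) K} {d : ℕ} (hF : F.IsHomogeneous d) (h : eval v F = 0) :
    F ∈ pointIdeal K v := by
  have h1 := sub_aeval_mem_pointIdeal hv F
  have h2 : eval (fun i => v i / v 0) F = 0 := by
    have h3 : eval v (aeval (fun i => C (v i / v 0) * X 0 :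
        Fin 4 → MvPolynomial (Fin 4) K) F) = eval v F := by
      have : (aeval v).comp (aeval (fun i => C (v i / v 0) * X 0 :
          Fin 4 → MvPolynomial (Fin 4) K)) = aeval v := by
        ext i
        simp [div_mul_cancel₀ _ hv]
      simpa [aeval_eq_eval] using DFunLike.congr_fun this F
    rw [aeval_smul_X_zero hF, h, map_mul, eval_C, map_pow, eval_X] at h3
    exact (mul_eq_zero.mp h3).resolve_right (pow_ne_zero _ hv)
  rwa [aeval_smul_X_zero hF, h2, map_zero, zero_mul, sub_zero] at h1

lemma formsIdeal_le {n : ℕ} {v : Fin n → Fin 4 → K} (hv : ∀ j, v j 0 ≠ 0) (d : ℕ) :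
    formsIdeal v d ≤ ⨅ j, pointIdeal K (v j) := by
  rw [formsIdeal, Ideal.span_le]
  rintro f ⟨hf, h⟩
  rw [SetLike.mem_coe, Ideal.mem_iInf]
  exact fun j => mem_pointIdeal_of_isHomogeneous (hv j) hf (h j)

lemma irrIdeal_mul_formsIdeal_le {n : ℕ} (v : Fin n → Fin 4 → K) (d : ℕ) :
    irrIdeal K * formsIdeal v d ≤ formsIdeal v (d + 1) := by
  rw [irrIdeal, formsIdeal, Ideal.span_mul_span', Ideal.span_le]
  rintro _ ⟨_, ⟨i, rfl⟩, f, ⟨hf, h⟩, rfl⟩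
  refine Ideal.subset_span ⟨?_, fun j => by simp [h]⟩
  rw [add_comm]
  exact (isHomogeneous_X K i).mul hf

lemma formsIdeal_le_pow {n : ℕ} (v : Fin n → Fin 4 → K) (d : ℕ) :
    formsIdeal v d ≤ irrIdeal K ^ d := by
  rw [formsIdeal, Ideal.span_le]
  rintro f ⟨hf, h⟩
  exact isHomogeneous_mem_irrIdeal_pow hf

lemma exists_X_mul_eq {n : ℕ} {v : Fin n → Fin 4 → K} (hv : ∀ j, v j 0 ≠ 0) {d : ℕ}
    {f : MvPolynomial (Fin 4) K} (hf : f.IsHomogeneous (d + 1)) (h : ∀ j, eval (v j) f = 0)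
    (h0 : dropZero f = 0) : ∃ b ∈ formsIdeal v d, f = X 0 * b := by
  obtain ⟨b, rfl⟩ := X_dvd_of_dropZero_eq_zero h0
  refine ⟨b, Ideal.subset_span ⟨isHomogeneous_of_X_mul hf, fun j => ?_⟩, rfl⟩
  have := h j
  rw [map_mul, eval_X] at this
  exact (mul_eq_zero.mp this).resolve_left (hv j)

/-- The points `v j` have interpolating forms of degree `d`. -/
def Separated {n : ℕ} (v : Fin n → Fin 4 → K) (d : ℕ) : Prop :=
  ∃ Q : Fin n → MvPolynomial (Fin 4) K, ∀ j, (Q j).IsHomogeneous d ∧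
    ∀ i, eval (v i) (Q j) = if i = j then 1 else 0

lemma Separated.exists_correction {n d : ℕ} {v : Fin n → Fin 4 → K} (hv : ∀ j, v j 0 ≠ 0)
    (hQ : Separated v d) {u : MvPolynomial (Fin 4) K} (hu : u.IsHomogeneous (d + 1)) :
    ∃ q : MvPolynomial (Fin 4) K, q ∈ Ideal.span {Q | Q.IsHomogeneous d ∧
        ∃ j, ∀ i, eval (v i) Q = if i = j then 1 else 0} ∧
      (u - X 0 * q).IsHomogeneous (d + 1) ∧ ∀ j, eval (v j) (u - X 0 * q) = 0 := by
  obtain ⟨Q, hQ⟩ := hQ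
  refine ⟨∑ j, C (eval (v j) u / v j 0) * Q j, sum_mem fun j _ => Ideal.mul_mem_left _ _
    (Ideal.subset_span (by exact ⟨(hQ j).1, j, (hQ j).2⟩)), ?_, fun j => ?_⟩
  · refine hu.sub ?_
    rw [add_comm]
    exact (isHomogeneous_X K 0).mul (IsHomogeneous.sum _ _ _ fun j _ => (hQ j).1.C_mul _)
  · have : ∑ i, eval (v i) u / v i 0 * (if j = i then 1 else 0) = eval (v j) u / v j 0 := by
      simp
    simp only [map_sub, map_mul, eval_X, map_sum, eval_C, fun i => (hQ i).2 j]
    rw [this, mul_div_cancel₀ _ (hv j), sub_self]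

theorem formsIdeal_mem_of_X_mul_mem {n d : ℕ} {v : Fin n → Fin 4 → K} (hv : ∀ j, v j 0 ≠ 0)
    (hQ : Separated v d) (r k : ℕ) (F : MvPolynomial (Fin 4) K)
    (hF : X 0 * F ∈ irrIdeal K ^ (k + 1) * formsIdeal v (d + 1) ^ r) :
    F ∈ irrIdeal K ^ k * formsIdeal v (d + 1) ^ r := by
  classical
  have hmon (α : Expo (Fin 3) (d + 1)) :
      (rename Fin.succ (monomial α.1 (1 : K))).IsHomogeneous (d + 1) :=
    (isHomogeneous_monomial _ α.2).rename_isHomogeneous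
  choose q hq hg hg0 using fun α => hQ.exists_correction hv (hmon α)
  set g : Expo (Fin 3) (d + 1) → MvPolynomial (Fin 4) K := fun α =>
    rename Fin.succ (monomial α.1 (1 : K)) - X 0 * q α with hgdef
  have hgd (α) : dropZero (g α) = monomial α.1 1 := by simp [hgdef]
  refine mem_of_X_mul_mem (δ := d + 1) (P := formsIdeal v (d + 1)) (N := formsIdeal v d) g
    (fun α => Ideal.subset_span ⟨hg α, hg0 α⟩) hgd (formsIdeal_le_pow v _) ?_
    (irrIdeal_mul_formsIdeal_le v d) ?_ r k F hF
  · rw [formsIdeal, Ideal.span_le]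
    rintro f ⟨hf, h⟩
    have : Fintype (Expo (Fin 3) (d + 1)) := Fintype.ofFinite _
    let c : Expo (Fin 3) (d + 1) → K := fun α => coeff α.1 (dropZero f)
    have hdf : (dropZero f).IsHomogeneous (d + 1) := by
      have := hf.aeval (Fin.cons 0 X : Fin 4 → MvPolynomial (Fin 3) K) (n := 1) (fun i => by
        refine Fin.cases ?_ (fun j => ?_) i
        · exact isHomogeneous_zero _ _ _
        · exact isHomogeneous_X _ _)
      rwa [one_mul] at this
    have hcf : dropZero (f - ∑ α, C (c α) * g α) = 0 := by
      rw [map_sub, map_sum, sub_eq_zero]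
      ext x
      rw [coeff_sum]
      have hC (a : K) : dropZero (C a : MvPolynomial (Fin 4) K) = C a := dropZero.commutes a
      simp only [map_mul, hgd, hC, coeff_C_mul, coeff_monomial]
      by_cases hx : x.degree = d + 1
      · rw [Finset.sum_eq_single_of_mem ⟨x, hx⟩ (Finset.mem_univ _)]
        · simp [c]
        · intro b _ hb
          rw [if_neg, mul_zero]
          exact fun h => hb (Subtype.ext h)
      · rw [hdf.coeff_eq_zero hx, Finset.sum_eq_zero]
        intro α _
        rw [if_neg, mul_zero]
        rintro rfl
        exact hx α.2
    obtain ⟨b, hb, e⟩ := exists_X_mul_eq hv (hf.sub (IsHomogeneous.sum Finset.univ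
      (fun α => C (c α) * g α) _ fun α _ => (hg α).C_mul _)) (fun j => by
        simp only [map_sub, h j, map_sum, map_mul, hgdef]
        rw [Finset.sum_eq_zero, sub_zero]
        intro α _
        have := hg0 α j
        rw [map_sub, map_mul] at this
        rw [this, mul_zero]) hcf
    rw [sub_eq_iff_eq_add'] at e
    rw [SetLike.mem_coe, e]
    refine add_mem (Ideal.mem_sup_left (sum_mem fun α _ => Ideal.mul_mem_left _ _
      (Ideal.subset_span ⟨α, rfl⟩))) (Ideal.mem_sup_right
      (Ideal.mul_mem_mul (Ideal.mem_span_singleton_self _) hb))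
  · intro α β i j hij
    refine exists_X_mul_eq hv ?_ (fun l => ?_) ?_
    · rw [add_comm (d + 1)]
      exact ((isHomogeneous_X K _).mul (hg α)).sub ((isHomogeneous_X K _).mul (hg β))
    · rw [map_sub, map_mul, map_mul, hg0, hg0, mul_zero, mul_zero, sub_zero]
    · simp only [map_sub, map_mul, dropZero_X_succ, hgd]
      rw [X, X, monomial_mul, monomial_mul, add_comm, hij, add_comm, sub_self]

end Points

section Routes

variable {K : Type} [Field K]

lemma mem_irrIdeal_pow_mul_span {S : Set (MvPolynomial (Fin 4) K)} {D k t : ℕ}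
    (hS : ∀ s ∈ S, s.IsHomogeneous D) (ht : D + k ≤ t) {F : MvPolynomial (Fin 4) K}
    (hF : F ∈ Ideal.span S) : homogeneousComponent t F ∈ irrIdeal K ^ k * Ideal.span S := by
  induction hF using Submodule.span_induction with
  | mem x hx =>
    rw [homogeneousComponent_of_mem (hS x hx)]
    split_ifs with h
    · have : k = 0 := by omega
      subst this
      rw [pow_zero, one_mul]
      exact Ideal.subset_span hx
    · exact zero_mem _
  | zero => rw [map_zero]; exact zero_mem _
  | add x y _ _ hx hy => rw [map_add]; exact add_mem hx hy
  | smul a x hx hx' =>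
    clear hx'
    induction hx using Submodule.span_induction generalizing a with
    | mem x hx =>
      obtain ⟨s, rfl⟩ : ∃ s, t = s + D := ⟨t - D, by omega⟩
      rw [smul_eq_mul, homogeneousComponent_mul_of_isHomogeneous (hS x hx)]
      refine Ideal.mul_mem_mul (Ideal.pow_le_pow_right (show k ≤ s by omega) ?_)
        (Ideal.subset_span hx)
      exact isHomogeneous_mem_irrIdeal_pow (homogeneousComponent_isHomogeneous _ _)
    | zero => rw [smul_zero, map_zero]; exact zero_mem _
    | add x y _ _ hx hy => rw [smul_add, map_add]; exact add_mem (hx a) (hy a)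
    | smul b x _ hx => rw [← mul_smul]; exact hx (a * b)

open Pointwise in
lemma span_pow_eq_span_isHomogeneous {S : Set (MvPolynomial (Fin 4) K)} {D : ℕ}
    (hS : ∀ s ∈ S, s.IsHomogeneous D) (r : ℕ) :
    ∃ T : Set (MvPolynomial (Fin 4) K), (∀ s ∈ T, s.IsHomogeneous (r * D)) ∧
      Ideal.span S ^ r = Ideal.span T := by
  induction r with
  | zero =>
    refine ⟨{1}, fun s hs => ?_, ?_⟩
    · rw [Set.mem_singleton_iff.mp hs, zero_mul]
      exact isHomogeneous_one _ _
    · rw [pow_zero, Ideal.one_eq_top, Ideal.span_singleton_one]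
  | succ r ih =>
    obtain ⟨T, hT, e⟩ := ih
    refine ⟨T * S, ?_, by rw [pow_succ, e, Ideal.span_mul_span']⟩
    rintro _ ⟨a, ha, b, hb, rfl⟩
    rw [add_mul, one_mul]
    exact (hT a ha).mul (hS b hb)

lemma mem_irrIdeal_pow_mul_formsIdeal_pow {n δ r k t : ℕ} {v : Fin n → Fin 4 → K}
    (ht : r * δ + k ≤ t) {F : MvPolynomial (Fin 4) K} (hFt : F.IsHomogeneous t)
    (hF : F ∈ formsIdeal v δ ^ r) : F ∈ irrIdeal K ^ k * formsIdeal v δ ^ r := by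
  obtain ⟨T, hT, e⟩ := span_pow_eq_span_isHomogeneous
    (S := {f : MvPolynomial (Fin 4) K | f.IsHomogeneous δ ∧ ∀ j, eval (v j) f = 0})
    (fun s hs => hs.1) r
  rw [formsIdeal, e] at hF ⊢
  have := mem_irrIdeal_pow_mul_span hT ht hF
  rwa [homogeneousComponent_eq_self hFt] at this

lemma formsIdeal_saturation {n d r : ℕ} {v : Fin n → Fin 4 → K} (hv : ∀ j, v j 0 ≠ 0)
    (hQ : Separated v d) {F : MvPolynomial (Fin 4) K}
    (hF : F ∈ ⨅ j, pointIdeal K (v j) ^ r) : ∃ N, X 0 ^ N * F ∈ formsIdeal v (d + 1) ^ r := by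
  set P := formsIdeal v (d + 1) with hPdef
  let C : Ideal (MvPolynomial (Fin 4) K) :=
    Submodule.comap (LinearMap.toSpanSingleton (MvPolynomial (Fin 4) K) _ F) (P ^ r)
  have hC (a) : a ∈ C ↔ a * F ∈ P ^ r := Iff.rfl
  have hPC : P ≤ C.radical := fun a ha =>
    ⟨r, (hC _).mpr (Ideal.mul_mem_right _ _ (Ideal.pow_mem_pow ha r))⟩
  have hQC : Ideal.span {Q : MvPolynomial (Fin 4) K | Q.IsHomogeneous d ∧
      ∃ j, ∀ i, eval (v i) Q = if i = j then 1 else 0} ≤ C.radical := by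
    rw [Ideal.span_le]
    rintro Q ⟨hQd, j, hj⟩
    refine ⟨r, (hC _).mpr ?_⟩
    have h1 : Ideal.span {Q} * pointIdeal K (v j) ≤ P := by
      rw [pointIdeal, Ideal.span_mul_span', Ideal.span_le]
      rintro _ ⟨_, rfl, l, ⟨hl, hl0⟩, rfl⟩
      refine Ideal.subset_span ⟨hQd.mul hl, fun i => ?_⟩
      simp only [map_mul, hj]
      split_ifs with h
      · rw [h, hl0, mul_zero]
      · rw [zero_mul]
    refine Ideal.pow_right_mono h1 r ?_
    rw [mul_pow]
    exact Ideal.mul_mem_mul (Ideal.pow_mem_pow (Ideal.mem_span_singleton_self Q) r)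
      (Ideal.mem_iInf.mp hF j)
  obtain ⟨q, hq, hhom, h0⟩ := hQ.exists_correction hv
    (u := X 0 ^ (d + 1)) (isHomogeneous_X_pow _ _)
  have h2 : (X 0 : MvPolynomial (Fin 4) K) ^ (d + 1) ∈ C.radical := by
    have h3 : X 0 ^ (d + 1) - X 0 * q ∈ C.radical := hPC (Ideal.subset_span ⟨hhom, h0⟩)
    have h4 : X 0 * q ∈ C.radical := Ideal.mul_mem_left _ _ (hQC hq)
    simpa using add_mem h3 h4
  obtain ⟨N, hN⟩ := h2
  exact ⟨(d + 1) * N, by rw [pow_mul]; exact hN⟩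

theorem mem_irrIdeal_pow_mul_of_mem_symbolic {n d r k t : ℕ} {v : Fin n → Fin 4 → K}
    (hv : ∀ j, v j 0 ≠ 0) (hQ : Separated v d) (ht : r * (d + 1) + k ≤ t)
    {F : MvPolynomial (Fin 4) K} (hFt : F.IsHomogeneous t)
    (hF : F ∈ ⨅ j, pointIdeal K (v j) ^ r) :
    F ∈ irrIdeal K ^ k * formsIdeal v (d + 1) ^ r := by
  obtain ⟨N, hN⟩ := formsIdeal_saturation hv hQ hF
  have h1 : X 0 ^ N * F ∈ irrIdeal K ^ (k + N) * formsIdeal v (d + 1) ^ r := by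
    refine mem_irrIdeal_pow_mul_formsIdeal_pow (t := N + t) (by omega) ?_ hN
    exact (isHomogeneous_X_pow 0 N).mul hFt
  clear hN
  induction N with
  | zero => simpa using h1
  | succ N ih =>
    apply ih
    apply formsIdeal_mem_of_X_mul_mem hv hQ
    rwa [← mul_assoc, ← pow_succ']

/-- No nonzero form of degree `D` vanishes to order `m` at all points `v j`. -/
def NoForm {n : ℕ} (v : Fin n → Fin 4 → K) (m D : ℕ) : Prop :=
  ∀ F : MvPolynomial (Fin 4) K, F.IsHomogeneous D → F ∈ ⨅ j, pointIdeal K (v j) ^ m → F = 0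

lemma symbolic_le_of_noForm {n m D : ℕ} {v : Fin n → Fin 4 → K} (h : NoForm v m D)
    {J : Ideal (MvPolynomial (Fin 4) K)}
    (hJ : ∀ t F, D < t → F.IsHomogeneous t → F ∈ ⨅ j, pointIdeal K (v j) ^ m → F ∈ J) :
    ⨅ j, pointIdeal K (v j) ^ m ≤ J := by
  intro F hF
  rw [← sum_homogeneousComponent F]
  refine sum_mem fun t _ => ?_
  have h1 := homogeneousComponent_mem_iInf_pow hF t
  have h2 := homogeneousComponent_isHomogeneous t F
  by_cases ht : D < t
  · exact hJ t _ ht h2 h1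
  · have h3 := h (X 0 ^ (D - t) * homogeneousComponent t F) (by
      have := (isHomogeneous_X_pow (R := K) (0 : Fin 4) (D - t)).mul h2
      rwa [Nat.sub_add_cancel (by omega)] at this) (Ideal.mul_mem_left _ _ h1)
    rw [(mul_eq_zero.mp h3).resolve_left (pow_ne_zero _ (X_ne_zero _))]
    exact zero_mem _

lemma iInf_pow_le_iInf_pow {n a b : ℕ} (h : a ≤ b) (v : Fin n → Fin 4 → K) :
    ⨅ j, pointIdeal K (v j) ^ b ≤ ⨅ j, pointIdeal K (v j) ^ a :=
  iInf_mono fun _ => Ideal.pow_le_pow_right h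

theorem containment_of_noForm {n d r : ℕ} (hr : 1 ≤ r) {v : Fin n → Fin 4 → K}
    (hv : ∀ j, v j 0 ≠ 0) (hQ : Separated v d)
    (h : NoForm v (3 * r - 2) (r * (d + 3) - 3)) :
    (⨅ j, pointIdeal K (v j) ^ (3 * r - 2)) ≤
      irrIdeal K ^ (2 * r - 2) * (⨅ j, pointIdeal K (v j)) ^ r := by
  refine symbolic_le_of_noForm h fun t F ht hFt hF => ?_
  refine Ideal.mul_mono_right (Ideal.pow_right_mono (formsIdeal_le hv (d + 1)) r) ?_
  refine mem_irrIdeal_pow_mul_of_mem_symbolic hv hQ ?_ hFt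
    (iInf_pow_le_iInf_pow (by omega) v hF)
  have : r * (d + 3) = r * (d + 1) + 2 * r := by ring
  omega

theorem containment_of_noForm_of_generated {n d r : ℕ} (hr : 2 ≤ r) {v : Fin n → Fin 4 → K}
    (hv : ∀ j, v j 0 ≠ 0) (hQ : Separated v d)
    (hgen : formsIdeal v (d + 1) ≤ irrIdeal K * formsIdeal v d)
    (h : NoForm v (3 * r - 2) (r * (d + 2) - 3)) :
    (⨅ j, pointIdeal K (v j) ^ (3 * r - 2)) ≤
      irrIdeal K ^ (2 * r - 2) * (⨅ j, pointIdeal K (v j)) ^ r := by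
  refine symbolic_le_of_noForm h fun t F ht hFt hF => ?_
  have h1 : F ∈ irrIdeal K ^ (r - 2) * formsIdeal v (d + 1) ^ r := by
    refine mem_irrIdeal_pow_mul_of_mem_symbolic hv hQ ?_ hFt
      (iInf_pow_le_iInf_pow (by omega) v hF)
    have : r * (d + 2) = r * (d + 1) + r := by ring
    omega
  have h2 : formsIdeal v (d + 1) ^ r ≤ irrIdeal K ^ r * (⨅ j, pointIdeal K (v j)) ^ r := by
    rw [← mul_pow]
    exact Ideal.pow_right_mono (hgen.trans (Ideal.mul_mono_right (formsIdeal_le hv d))) r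
  have h3 := Ideal.mul_mono_right (I := irrIdeal K ^ (r - 2)) h2 h1
  rw [← mul_assoc, ← pow_add] at h3
  convert h3 using 3
  omega

end Routes

section Generic

variable {K : Type} [Field K] {n : ℕ}

/-- A property of `n` vectors of `K⁴` that holds off a proper hypersurface. -/
def Generic (p : (Fin n → Fin 4 → K) → Prop) : Prop :=
  ∃ G : MvPolynomial (Fin n × Fin 4) K, G ≠ 0 ∧
    ∀ v : Fin n → Fin 4 → K, eval (fun q => v q.1 q.2) G ≠ 0 → p v

lemma Generic.mono {p q : (Fin n → Fin 4 → K) → Prop} (hp : Generic p) (h : ∀ v, p v → q v) :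
    Generic q :=
  let ⟨G, h0, hG⟩ := hp
  ⟨G, h0, fun v hv => h v (hG v hv)⟩

lemma Generic.and {p q : (Fin n → Fin 4 → K) → Prop} (hp : Generic p) (hq : Generic q) :
    Generic fun v => p v ∧ q v := by
  obtain ⟨G, h0, hG⟩ := hp
  obtain ⟨H, h1, hH⟩ := hq
  refine ⟨G * H, mul_ne_zero h0 h1, fun v hv => ?_⟩
  rw [map_mul] at hv
  exact ⟨hG v (left_ne_zero_of_mul hv), hH v (right_ne_zero_of_mul hv)⟩

lemma generic_of_eval_ne_zero (G : MvPolynomial (Fin n × Fin 4) K) {v₀ : Fin n → Fin 4 → K}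
    (h : eval (fun q => v₀ q.1 q.2) G ≠ 0) :
    Generic fun v : Fin n → Fin 4 → K => eval (fun q => v q.1 q.2) G ≠ 0 :=
  ⟨G, fun h0 => h (by rw [h0, map_zero]), fun _ => id⟩

lemma generic_zero_ne_zero : Generic fun v : Fin n → Fin 4 → K => ∀ j, v j 0 ≠ 0 := by
  refine (generic_of_eval_ne_zero (∏ j, X (j, 0)) (v₀ := fun _ _ => 1) (by simp)).mono ?_
  intro v hv j
  rw [map_prod, Finset.prod_ne_zero_iff] at hv
  simpa using hv j (Finset.mem_univ j)

/-- Specialisation of a matrix of polynomials at a tuple of vectors. -/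
def specMatrix {ι κ : Type} (A : Matrix ι κ (MvPolynomial (Fin n × Fin 4) K))
    (v : Fin n → Fin 4 → K) : Matrix ι κ K :=
  A.map (eval fun q => v q.1 q.2)

/-- A constant matrix, with polynomial entries. -/
def constMatrix {ι κ : Type} (B : Matrix ι κ K) :
    Matrix ι κ (MvPolynomial (Fin n × Fin 4) K) :=
  B.map C

lemma specMatrix_constMatrix {ι κ : Type} (B : Matrix ι κ K) (v : Fin n → Fin 4 → K) :
    specMatrix (constMatrix B) v = B := by
  ext i j
  simp [specMatrix, constMatrix]

lemma specMatrix_mul {ι κ l : Type} [Fintype κ] (A : Matrix ι κ (MvPolynomial (Fin n × Fin 4) K))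
    (B : Matrix κ l (MvPolynomial (Fin n × Fin 4) K)) (v : Fin n → Fin 4 → K) :
    specMatrix (A * B) v = specMatrix A v * specMatrix B v :=
  Matrix.map_mul

variable {ι κ : Type} [Fintype ι] [Fintype κ] [DecidableEq ι] [DecidableEq κ]

omit [Fintype κ] [DecidableEq κ] in
lemma eval_det_eq (A : Matrix ι ι (MvPolynomial (Fin n × Fin 4) K)) (v : Fin n → Fin 4 → K) :
    eval (fun q => v q.1 q.2) A.det = (specMatrix A v).det :=
  by rw [RingHom.map_det]; rfl

omit [DecidableEq κ] in
lemma generic_isUnit_mul (A : Matrix ι κ (MvPolynomial (Fin n × Fin 4) K))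
    (B : Matrix κ ι (MvPolynomial (Fin n × Fin 4) K)) {v₀ : Fin n → Fin 4 → K}
    (h : specMatrix A v₀ * specMatrix B v₀ = 1) :
    Generic fun v => IsUnit (specMatrix A v * specMatrix B v) := by
  refine (generic_of_eval_ne_zero (A * B).det (v₀ := v₀) ?_).mono ?_
  · rw [eval_det_eq, specMatrix_mul, h, Matrix.det_one]
    exact one_ne_zero
  · intro v hv
    rw [eval_det_eq, specMatrix_mul] at hv
    exact (Matrix.isUnit_iff_isUnit_det _).mpr (isUnit_iff_ne_zero.mpr hv)

lemma generic_injective (A : Matrix ι κ (MvPolynomial (Fin n × Fin 4) K))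
    {v₀ : Fin n → Fin 4 → K} (h : ∀ c, (specMatrix A v₀).mulVec c = 0 → c = 0) :
    Generic fun v => ∀ c, (specMatrix A v).mulVec c = 0 → c = 0 := by
  obtain ⟨g, hg⟩ := LinearMap.exists_leftInverse_of_injective (specMatrix A v₀).mulVecLin
    (LinearMap.ker_eq_bot'.mpr h)
  have hB : LinearMap.toMatrix' g * specMatrix A v₀ = 1 := by
    rw [← Matrix.toLin'_apply', ← LinearMap.toMatrix'.injective.eq_iff,
      LinearMap.toMatrix'_comp, LinearMap.toMatrix'_toLin', LinearMap.toMatrix'_id] at hg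
    exact hg
  refine (generic_isUnit_mul (constMatrix (LinearMap.toMatrix' g)) A (v₀ := v₀)
    (by rw [specMatrix_constMatrix, hB])).mono fun v hv c hc => ?_
  rw [specMatrix_constMatrix] at hv
  refine Matrix.mulVec_injective_of_isUnit hv ?_
  rw [← Matrix.mulVec_mulVec, hc, Matrix.mulVec_zero, Matrix.mulVec_zero]

lemma generic_surjective (A : Matrix ι κ (MvPolynomial (Fin n × Fin 4) K))
    {v₀ : Fin n → Fin 4 → K} (h : ∀ w, ∃ c, (specMatrix A v₀).mulVec c = w) :
    Generic fun v => ∀ w, ∃ c, (specMatrix A v).mulVec c = w := by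
  obtain ⟨g, hg⟩ := LinearMap.exists_rightInverse_of_surjective (specMatrix A v₀).mulVecLin
    (LinearMap.range_eq_top.mpr h)
  have hB : specMatrix A v₀ * LinearMap.toMatrix' g = 1 := by
    rw [← Matrix.toLin'_apply', ← LinearMap.toMatrix'.injective.eq_iff,
      LinearMap.toMatrix'_comp, LinearMap.toMatrix'_toLin', LinearMap.toMatrix'_id] at hg
    exact hg
  refine (generic_isUnit_mul A (constMatrix (LinearMap.toMatrix' g)) (v₀ := v₀)
    (by rw [specMatrix_constMatrix, hB])).mono fun v hv w => ?_
  rw [specMatrix_constMatrix] at hv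
  obtain ⟨c, hc⟩ := (Matrix.mulVec_surjective_iff_isUnit.mpr hv) w
  exact ⟨(LinearMap.toMatrix' g).mulVec c, by rw [Matrix.mulVec_mulVec, hc]⟩

end Generic

section AffineVanishing

variable {K : Type} [Field K] {N : ℕ}

lemma mem_idealOfVars_pow_iff_homogeneousComponent {h : MvPolynomial (Fin N) K} {k : ℕ} :
    h ∈ idealOfVars (Fin N) K ^ k ↔ ∀ t < k, homogeneousComponent t h = 0 := by
  rw [mem_pow_idealOfVars_iff']
  constructor
  · intro H t ht
    ext x
    rw [coeff_homogeneousComponent, coeff_zero]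
    split_ifs with hx
    · exact H x (by omega)
    · rfl
  · intro H x hx
    have := congrArg (coeff x) (H _ hx)
    rwa [coeff_homogeneousComponent, if_pos rfl, coeff_zero] at this

lemma mem_idealOfVars_pow_of_mul_linear {h l : MvPolynomial (Fin N) K} (hl : l.IsHomogeneous 1)
    (h0 : l ≠ 0) {k : ℕ} (hh : l * h ∈ idealOfVars (Fin N) K ^ k) :
    h ∈ idealOfVars (Fin N) K ^ (k - 1) := by
  rw [mem_idealOfVars_pow_iff_homogeneousComponent] at hh ⊢
  intro t ht
  have := hh (t + 1) (by omega)
  rw [mul_comm, homogeneousComponent_mul_of_isHomogeneous hl] at this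
  exact (mul_eq_zero.mp this).resolve_right h0

lemma isHomogeneous_one_mem_idealOfVars {l : MvPolynomial (Fin N) K} (hl : l.IsHomogeneous 1) :
    l ∈ idealOfVars (Fin N) K := by
  rw [← pow_one (idealOfVars (Fin N) K), mem_idealOfVars_pow_iff_homogeneousComponent]
  intro t ht
  rw [homogeneousComponent_of_mem hl, if_neg (by omega)]

lemma mem_idealOfVars_pow_of_mul_unit {h l : MvPolynomial (Fin N) K} (hl : l.IsHomogeneous 1)
    {u : K} (hu : u ≠ 0) {k : ℕ} (hh : (l + C u) * h ∈ idealOfVars (Fin N) K ^ k) :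
    h ∈ idealOfVars (Fin N) K ^ k := by
  suffices H : ∀ t ≤ k, h ∈ idealOfVars (Fin N) K ^ t from H k le_rfl
  intro t
  induction t with
  | zero => simp
  | succ t ih =>
    intro ht
    have h1 : l * h ∈ idealOfVars (Fin N) K ^ (t + 1) := by
      rw [pow_succ']
      exact Ideal.mul_mem_mul (isHomogeneous_one_mem_idealOfVars hl) (ih (by omega))
    have h2 := Ideal.mul_mem_left _ (C u⁻¹) (sub_mem (Ideal.pow_le_pow_right ht hh) h1)
    rwa [show C u⁻¹ * ((l + C u) * h - l * h) = (C u⁻¹ * C u) * h by ring, ← C_mul,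
      inv_mul_cancel₀ hu, C_1, one_mul] at h2

lemma totalDegree_aeval_le_of_forall_le_one {M : ℕ} {g : Fin N → MvPolynomial (Fin M) K}
    (hg : ∀ i, (g i).totalDegree ≤ 1) (f : MvPolynomial (Fin N) K) :
    (aeval g f).totalDegree ≤ f.totalDegree := by
  rw [aeval_def, eval₂_eq']
  refine totalDegree_finsetSum_le fun x hx => (totalDegree_mul _ _).trans ?_
  rw [algebraMap_eq, totalDegree_C, zero_add]
  refine (totalDegree_finsetProd _ _).trans (le_trans ?_ (le_totalDegree hx))
  rw [Finsupp.sum_fintype _ _ fun _ => rfl]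
  exact Finset.sum_le_sum fun i _ => (totalDegree_pow _ _).trans
    ((Nat.mul_le_mul_left _ (hg i)).trans_eq (mul_one _))

/-- The translation of the affine space moving the origin to `p`. -/
def translateHom (K : Type) [Field K] (p : Fin N → ℤ) :
    MvPolynomial (Fin N) K →ₐ[K] MvPolynomial (Fin N) K :=
  aeval fun i => X i + C (p i : K)

/-- The polynomial `f` vanishes to order at least `m` at the integer point `p`. -/
def VanishesTo (f : MvPolynomial (Fin N) K) (p : Fin N → ℤ) (m : ℕ) : Prop :=
  translateHom K p f ∈ idealOfVars (Fin N) K ^ m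

lemma VanishesTo.mono {f : MvPolynomial (Fin N) K} {p : Fin N → ℤ} {a b : ℕ}
    (h : VanishesTo f p b) (hab : a ≤ b) : VanishesTo f p a :=
  Ideal.pow_le_pow_right hab h

lemma eq_zero_of_vanishesTo {f : MvPolynomial (Fin N) K} {p : Fin N → ℤ} {m D : ℕ}
    (hf : f.totalDegree ≤ D) (hD : D < m) (h : VanishesTo f p m) : f = 0 := by
  have h0 : translateHom K p f = 0 := by
    have hd : (translateHom K p f).totalDegree ≤ D :=
      (totalDegree_aeval_le_of_forall_le_one (fun i => (totalDegree_add _ _).trans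
        (max_le (totalDegree_X i).le ((totalDegree_C _).le.trans zero_le_one))) f).trans hf
    rw [VanishesTo, mem_pow_idealOfVars_iff'] at h
    ext x
    by_contra hx
    have hx' := mem_support_iff.mpr hx
    have := le_totalDegree hx'
    refine hx (h x ?_)
    rw [Finsupp.degree_apply]
    exact (this.trans hd).trans_lt hD
  have h1 : (translateHom K (-p)).comp (translateHom K p) = AlgHom.id K _ := by
    ext i
    simp [translateHom]
  simpa [h0] using (DFunLike.congr_fun h1 f).symm

/-- Restriction to the graph `xᵢ = c + ∑ aⱼ xⱼ`. -/
def graphRestrict (K : Type) [Field K] (i : Fin (N + 1)) (a : Fin N → ℤ) (c : ℤ) :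
    MvPolynomial (Fin (N + 1)) K →ₐ[K] MvPolynomial (Fin N) K :=
  aeval (i.insertNth (C (c : K) + ∑ j, C (a j : K) * X j) X : Fin (N + 1) → _)

/-- The linear polynomial `xᵢ - ∑ aⱼ xⱼ`. -/
def graphForm (K : Type) [Field K] (i : Fin (N + 1)) (a : Fin N → ℤ) :
    MvPolynomial (Fin (N + 1)) K :=
  X i - ∑ j, C (a j : K) * X (i.succAbove j)

lemma graphForm_isHomogeneous (i : Fin (N + 1)) (a : Fin N → ℤ) :
    (graphForm K i a).IsHomogeneous 1 :=
  (isHomogeneous_X _ _).sub (IsHomogeneous.sum _ _ _ fun _ _ => isHomogeneous_C_mul_X _ _)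

lemma eval_graphForm (i : Fin (N + 1)) (a : Fin N → ℤ) (u : K) :
    eval (i.insertNth u 0 : Fin (N + 1) → K) (graphForm K i a) = u := by
  simp [graphForm]

lemma graphForm_sub_C_ne_zero (i : Fin (N + 1)) (a : Fin N → ℤ) (c : K) :
    graphForm K i a - C c ≠ 0 := by
  intro h
  have := congrArg (eval (i.insertNth (c + 1) 0 : Fin (N + 1) → K)) h
  rw [map_sub, eval_graphForm, eval_C, map_zero] at this
  simp at this

lemma graphForm_ne_zero (i : Fin (N + 1)) (a : Fin N → ℤ) : graphForm K i a ≠ 0 := by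
  simpa using graphForm_sub_C_ne_zero i a (0 : K)

lemma totalDegree_graphRestrict_le (i : Fin (N + 1)) (a : Fin N → ℤ) (c : ℤ)
    (f : MvPolynomial (Fin (N + 1)) K) :
    (graphRestrict K i a c f).totalDegree ≤ f.totalDegree := by
  refine totalDegree_aeval_le_of_forall_le_one (fun k => ?_) f
  refine Fin.succAboveCases i ?_ (fun j => ?_) k
  · rw [Fin.insertNth_apply_same]
    refine (totalDegree_add _ _).trans (max_le ((totalDegree_C _).le.trans zero_le_one) ?_)
    refine totalDegree_finsetSum_le fun j _ => (totalDegree_mul _ _).trans ?_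
    rw [totalDegree_C, totalDegree_X]
  · simp

lemma VanishesTo.graphRestrict {f : MvPolynomial (Fin (N + 1)) K} {p : Fin (N + 1) → ℤ} {m : ℕ}
    (h : VanishesTo f p m) {i : Fin (N + 1)} {a : Fin N → ℤ} {c : ℤ}
    (hp : p i = c + ∑ j, a j * p (i.succAbove j)) :
    VanishesTo (graphRestrict K i a c f) (i.removeNth p) m := by
  have e : (translateHom K (i.removeNth p)).comp (_root_.graphRestrict K i a c) =
      (_root_.graphRestrict K i a 0).comp (translateHom K p) := by
    ext k : 1
    refine Fin.succAboveCases i ?_ (fun j => ?_) k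
    · simp [translateHom, _root_.graphRestrict, hp, Fin.removeNth, mul_add, Finset.sum_add_distrib]
      ring
    · simp [translateHom, _root_.graphRestrict, Fin.removeNth]
  have e' := DFunLike.congr_fun e f
  simp only [AlgHom.comp_apply] at e'
  rw [VanishesTo, e']
  have h1 := Ideal.mem_map_of_mem (_root_.graphRestrict K i a 0) h
  rw [Ideal.map_pow] at h1
  refine Ideal.pow_right_mono ?_ m h1
  rw [idealOfVars, Ideal.map_span, Ideal.span_le]
  rintro _ ⟨_, ⟨k, rfl⟩, rfl⟩
  refine isHomogeneous_one_mem_idealOfVars ?_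
  refine Fin.succAboveCases i ?_ (fun j => ?_) k
  · simp only [_root_.graphRestrict, aeval_X, Fin.insertNth_apply_same,
      Int.cast_zero, C_0, zero_add]
    exact IsHomogeneous.sum _ _ _ fun _ _ => isHomogeneous_C_mul_X _ _
  · simpa [_root_.graphRestrict] using isHomogeneous_X K j

lemma graphForm_dvd {f : MvPolynomial (Fin (N + 1)) K} {i : Fin (N + 1)} {a : Fin N → ℤ} {c : ℤ}
    (h : graphRestrict K i a c f = 0) : graphForm K i a - C (c : K) ∣ f := by
  rw [← Ideal.mem_span_singleton, ← Ideal.Quotient.eq_zero_iff_mem]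
  set J := Ideal.span {graphForm K i a - C (c : K)} with hJ
  have : Ideal.Quotient.mkₐ K J = ((Ideal.Quotient.mkₐ K J).comp (rename i.succAbove)).comp
      (graphRestrict K i a c) := by
    ext k : 1
    refine Fin.succAboveCases i ?_ (fun j => ?_) k
    · simp only [AlgHom.comp_apply, graphRestrict, aeval_X, Fin.insertNth_apply_same,
        Ideal.Quotient.mkₐ_eq_mk]
      rw [Ideal.Quotient.eq]
      refine Ideal.mem_span_singleton.mpr (dvd_of_eq ?_)
      simp [graphForm]
      ring
    · simp [graphRestrict]
  have h2 := DFunLike.congr_fun this f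
  simp only [AlgHom.comp_apply, h, map_zero, Ideal.Quotient.mkₐ_eq_mk] at h2
  exact h2

lemma VanishesTo.of_mul_graphForm [CharZero K] {g : MvPolynomial (Fin (N + 1)) K}
    {p : Fin (N + 1) → ℤ} {m : ℕ} {i : Fin (N + 1)} {a : Fin N → ℤ} {c : ℤ}
    (h : VanishesTo ((graphForm K i a - C (c : K)) * g) p m) :
    VanishesTo g p (if p i = c + ∑ j, a j * p (i.succAbove j) then m - 1 else m) := by
  have e : translateHom K p (graphForm K i a - C (c : K)) = graphForm K i a +
      C ((p i - (c + ∑ j, a j * p (i.succAbove j)) : ℤ) : K) := by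
    simp [translateHom, graphForm, mul_add, Finset.sum_add_distrib]
    ring
  rw [VanishesTo, map_mul, e] at h
  split_ifs with hp
  · rw [hp, sub_self, Int.cast_zero, C_0, add_zero] at h
    exact mem_idealOfVars_pow_of_mul_linear (graphForm_isHomogeneous i a)
      (graphForm_ne_zero i a) h
  · refine mem_idealOfVars_pow_of_mul_unit (graphForm_isHomogeneous i a) ?_ h
    rw [Int.cast_ne_zero]
    exact sub_ne_zero_of_ne hp

/-- Bézout: a polynomial restricting to zero on a graph is a multiple of its equation, and the
quotient keeps the vanishing orders, up to one on the graph. -/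
lemma exists_quotient_of_graphRestrict_eq_zero [CharZero K] {f : MvPolynomial (Fin (N + 1)) K}
    {i : Fin (N + 1)} {a : Fin N → ℤ} {c : ℤ} (h : graphRestrict K i a c f = 0) (h0 : f ≠ 0) :
    ∃ g : MvPolynomial (Fin (N + 1)) K, g ≠ 0 ∧ g.totalDegree + 1 = f.totalDegree ∧
      ∀ p m, VanishesTo f p m →
      VanishesTo g p (if p i = c + ∑ j, a j * p (i.succAbove j) then m - 1 else m) := by
  obtain ⟨g, rfl⟩ := graphForm_dvd h
  have hg := right_ne_zero_of_mul h0
  refine ⟨g, hg, ?_, fun p m => VanishesTo.of_mul_graphForm⟩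
  rw [totalDegree_mul_of_isDomain (left_ne_zero_of_mul h0) hg, add_comm]
  congr 1
  refine le_antisymm ?_ ?_
  · rw [Nat.one_le_iff_ne_zero]
    intro h
    rw [totalDegree_eq_zero_iff_eq_C] at h
    have h1 := congrArg (eval (i.insertNth (0 : K) 0 : Fin (N + 1) → K)) h
    have h2 := congrArg (eval (i.insertNth (1 : K) 0 : Fin (N + 1) → K)) h
    rw [map_sub, eval_graphForm] at h1 h2
    simp only [eval_C] at h1 h2
    rw [← h1] at h2
    simp at h2
  · refine (totalDegree_sub _ _).trans (max_le ?_ ((totalDegree_C _).le.trans zero_le_one))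
    exact (graphForm_isHomogeneous i a).totalDegree_le

end AffineVanishing

section Layers

variable {K : Type} [Field K] {N : ℕ}

/-- Only the zero polynomial has degree at most `D` and vanishes to order `e.2` at `e.1` for all
`e` in the list `l`. -/
def NoPoly (K : Type) [Field K] (D : ℕ) (l : List ((Fin N → ℤ) × ℕ)) : Prop :=
  ∀ f : MvPolynomial (Fin N) K, f.totalDegree ≤ D → (∀ e ∈ l, VanishesTo f e.1 e.2) → f = 0

/-- The points of the list `l`, all with multiplicity `m`. -/
def fat (l : List (Fin N → ℤ)) (m : ℕ) : List ((Fin N → ℤ) × ℕ) :=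
  l.map fun p => (p, m)

lemma forall_mem_fat {l : List (Fin N → ℤ)} {m : ℕ} {P : (Fin N → ℤ) × ℕ → Prop} :
    (∀ e ∈ fat l m, P e) ↔ ∀ p ∈ l, P (p, m) := by
  simp [fat]

/-- A finite set of points together with a function `bound` such that no nonzero polynomial of
degree at most `X` has multiplicity more than `bound X` at all of them. -/
structure Layer (K : Type) [Field K] (N : ℕ) where
  /-- the points -/
  pts : List (Fin N → ℤ)
  /-- the bound for the multiplicity -/
  bound : ℕ → ℕ
  noPoly : ∀ X m, bound X < m → NoPoly K X (fat pts m)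

/-- The union of copies of configurations in parallel hyperplanes. -/
def stackPts (L : List (Layer K N)) : List (Fin (N + 1) → ℤ) :=
  (List.finRange L.length).flatMap fun t => (L.get t).pts.map (Fin.cons (t : ℤ))

lemma length_stackPts (L : List (Layer K N)) :
    (stackPts L).length = (L.map fun s => s.pts.length).sum := by
  simp only [stackPts, List.length_flatMap, List.length_map]
  rw [← List.ofFn_eq_map, List.sum_ofFn, ← Fin.sum_univ_fun_getElem]
  rfl

variable [CharZero K]

lemma noPoly_stackPts (L : List (Layer K N)) {D m : ℕ}
    (h : ∀ X ≤ D, D < X + (L.map fun s => m - s.bound X).sum) :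
    NoPoly K D (fat (stackPts L) m) := by
  have key : ∀ X, ∀ k : Fin L.length → ℕ, (∀ t, k t ≤ m) → X + ∑ t, (m - k t) = D →
      ∀ f : MvPolynomial (Fin (N + 1)) K, f.totalDegree ≤ X →
      (∀ t, ∀ q ∈ (L.get t).pts, VanishesTo f (Fin.cons (t : ℤ) q) (k t)) → f = 0 := by
    intro X
    induction X using Nat.strong_induction_on with
    | _ X ih =>
    intro k hk hX f hf hv
    by_contra hf0
    obtain ⟨t, ht⟩ : ∃ t, (L.get t).bound X < k t := by
      by_contra! H
      have h1 := h X (hX ▸ Nat.le_add_right _ _)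
      rw [← Fin.sum_univ_fun_getElem] at h1
      have h2 := Finset.sum_le_sum fun t (_ : t ∈ Finset.univ) => Nat.sub_le_sub_left (H t) m
      simp only [List.get_eq_getElem] at h2
      omega
    have h0 : graphRestrict K 0 0 (t : ℤ) f = 0 := by
      refine (L.get t).noPoly _ _ ht _ ((totalDegree_graphRestrict_le _ _ _ f).trans hf)
        (forall_mem_fat.mpr fun q hq => ?_)
      simpa using (hv t q hq).graphRestrict (i := 0) (a := 0) (c := t) (by simp)
    obtain ⟨g, hg, hd, hgv⟩ := exists_quotient_of_graphRestrict_eq_zero h0 hf0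
    refine hg (ih (X - 1) (by omega) (Function.update k t (k t - 1)) (fun s => ?_) ?_ g
      (by omega) ?_)
    · rcases eq_or_ne s t with rfl | hs
      · simpa using (Nat.sub_le _ _).trans (hk s)
      · simpa [hs] using hk s
    · rw [← Finset.add_sum_erase _ _ (Finset.mem_univ t)] at hX ⊢
      rw [Function.update_self, Finset.sum_congr rfl (g := fun s => m - k s)]
      · have := hk t
        omega
      · intro s hs
        rw [Function.update_of_ne (Finset.ne_of_mem_erase hs)]
    · intro s q hq
      refine (hgv _ _ (hv s q hq)).mono ?_
      rcases eq_or_ne s t with rfl | hs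
      · simp
      · simp [hs, Fin.val_inj]
  intro f hf hv
  refine key D (fun _ => m) (fun _ => le_rfl) (by simp) f hf fun t q hq => ?_
  rw [forall_mem_fat] at hv
  exact hv _ (List.mem_flatMap.mpr ⟨t, List.mem_finRange t, List.mem_map.mpr ⟨q, hq, rfl⟩⟩)

/-- Parallel configurations, as a configuration. -/
def Layer.stack (L : List (Layer K N)) (b : ℕ → ℕ)
    (h : ∀ D m, b D < m → ∀ X ≤ D, D < X + (L.map fun s => m - s.bound X).sum) :
    Layer K (N + 1) :=
  ⟨stackPts L, b, fun D m hm => noPoly_stackPts L (h D m hm)⟩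

omit [CharZero K] in
lemma noPoly_zero {m : ℕ} (hm : 0 < m) : NoPoly K 0 (fat [(Fin.elim0 : Fin 0 → ℤ)] m) :=
  fun _ hf hv => eq_zero_of_vanishesTo hf hm (hv (Fin.elim0, m) (by simp [fat]))

/-- The point of the affine space of dimension zero. -/
def Layer.origin : Layer K 0 :=
  ⟨[Fin.elim0], fun _ => 0, fun _ _ hm f _ hv =>
    noPoly_zero hm f (by rw [eq_C_of_isEmpty f, totalDegree_C]) hv⟩

variable (K) in
/-- Points on a line. -/
def Layer.line (a : ℕ) (ha : 0 < a) : Layer K 1 :=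
  .stack (List.replicate a .origin) (· / a) fun D m hm X hX => by
    rw [Nat.div_lt_iff_lt_mul ha] at hm
    simp [Layer.origin]
    nlinarith

variable (K) in
/-- A square grid. -/
def Layer.square (a : ℕ) (ha : 0 < a) : Layer K 2 :=
  .stack (List.replicate a (.line K a ha)) (· / a) fun D m hm X hX => by
    rw [Nat.div_lt_iff_lt_mul ha] at hm
    simp only [List.map_replicate, List.sum_replicate, smul_eq_mul, Nat.mul_sub]
    have := Nat.mul_div_le X a
    have e : (Layer.line K a ha).bound X = X / a := rfl
    rw [e, mul_comm a m]
    omega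

variable (K) in
/-- Three points not on a line. -/
def Layer.triangle : Layer K 2 :=
  .stack [.line K 2 two_pos, .line K 1 one_pos] (2 * · / 3) fun D m hm X hX => by
    have e (a) (ha : 0 < a) : (Layer.line K a ha).bound X = X / a := rfl
    simp only [List.map_cons, List.map_nil, List.sum_cons, List.sum_nil, e]
    omega

@[simp] lemma Layer.length_line (a : ℕ) (ha : 0 < a) : (Layer.line K a ha).pts.length = a := by
  simp [Layer.line, Layer.stack, length_stackPts, Layer.origin]

@[simp] lemma Layer.length_square (a : ℕ) (ha : 0 < a) :
    (Layer.square K a ha).pts.length = a * a := by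
  simp [Layer.square, Layer.stack, length_stackPts]

@[simp] lemma Layer.length_triangle : (Layer.triangle K).pts.length = 3 := by
  simp [Layer.triangle, Layer.stack, length_stackPts]

@[simp] lemma Layer.bound_square (a : ℕ) (ha : 0 < a) (X : ℕ) :
    (Layer.square K a ha).bound X = X / a := rfl

@[simp] lemma Layer.bound_triangle (X : ℕ) : (Layer.triangle K).bound X = 2 * X / 3 := rfl

variable (K) in
/-- Some `n` integer points impose independent conditions in the numerical range relevant for
the containment, for regularity `k`. -/
def Bounded (n k r : ℕ) : Prop :=
  ∃ l : List (Fin 3 → ℤ), l.length ≤ n ∧ NoPoly K (r * (k + 2) - 3) (fat l (3 * r - 2))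

omit [CharZero K] in
lemma Bounded.mono {n n' k r : ℕ} (h : Bounded K n k r) (hn : n ≤ n') : Bounded K n' k r :=
  let ⟨l, hl, h⟩ := h
  ⟨l, hl.trans hn, h⟩

lemma bounded_of_stack (L : List (Layer K 2)) {n k r : ℕ}
    (hn : (L.map fun s => s.pts.length).sum ≤ n)
    (h : ∀ X ≤ r * (k + 2) - 3,
      r * (k + 2) - 3 < X + (L.map fun s => 3 * r - 2 - s.bound X).sum) : Bounded K n k r :=
  ⟨stackPts L, (length_stackPts L).trans_le hn, noPoly_stackPts L h⟩

lemma bounded_cube {a k r : ℕ} (hr : 2 ≤ r) (ha : 0 < a) (hk : k + 1 ≤ 2 * a) :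
    Bounded K (a ^ 3) k r := by
  refine bounded_of_stack (List.replicate a (.square K a ha)) ?_ fun X hX => ?_
  · simp [pow_succ, mul_assoc]
  · simp only [List.map_replicate, List.sum_replicate, smul_eq_mul, Nat.mul_sub,
      Layer.bound_square]
    have h1 := Nat.mul_div_le X a
    have h2 : r * (k + 2) + a * 2 < a * (3 * r) + 3 := by
      obtain ⟨a, rfl⟩ := Nat.exists_eq_add_of_le' ha
      obtain ⟨r, rfl⟩ := Nat.exists_eq_add_of_le' hr
      have : (r + 2) * (k + 2) ≤ (r + 2) * (2 * (a + 1) + 1) := Nat.mul_le_mul_left _ (by omega)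
      nlinarith
    have h3 : 2 * 2 ≤ r * (k + 2) := Nat.mul_le_mul hr (by omega)
    omega

lemma bounded_one {r : ℕ} (hr : 2 ≤ r) : Bounded K 1 1 r :=
  bounded_cube (a := 1) hr one_pos le_rfl

lemma bounded_four {r : ℕ} (hr : 2 ≤ r) : Bounded K 4 2 r :=
  bounded_of_stack [.triangle K, .square K 1 one_pos] (by simp) fun X hX => by
    simp
    omega

lemma bounded_seven {r : ℕ} (hr : 3 ≤ r) : Bounded K 7 3 r :=
  bounded_of_stack [.triangle K, .square K 2 two_pos] (by simp) fun X hX => by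
    simp
    omega

lemma bounded_fifteen {r : ℕ} (hr : 3 ≤ r) : Bounded K 15 4 r :=
  bounded_of_stack [.square K 3 three_pos, .square K 2 two_pos, .square K 1 one_pos] (by simp)
    fun X hX => by
    simp
    omega

lemma bounded_fortyFive {r : ℕ} (hr : 2 ≤ r) : Bounded K 45 6 r :=
  bounded_of_stack (List.replicate 2 (.square K 4 (by simp)) ++ List.replicate 1 (.square K 3 (by simp)) ++ List.replicate 1 (.square K 2 (by simp))) (by simp) fun X hX => by
    simp
    omega

lemma bounded_ninetyOne {r : ℕ} (hr : 2 ≤ r) : Bounded K 91 8 r :=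
  bounded_of_stack (List.replicate 2 (.square K 5 (by simp)) ++ List.replicate 2 (.square K 4 (by simp)) ++ List.replicate 1 (.square K 3 (by simp))) (by simp) fun X hX => by
    simp
    omega

lemma bounded_116 {r : ℕ} (hr : 2 ≤ r) : Bounded K 116 9 r :=
  bounded_of_stack (List.replicate 4 (.square K 5 (by simp)) ++ List.replicate 1 (.square K 4 (by simp))) (by simp) fun X hX => by
    simp
    omega

lemma bounded_163 {r : ℕ} (hr : 2 ≤ r) : Bounded K 163 10 r :=
  bounded_of_stack (List.replicate 2 (.square K 6 (by simp)) ++ List.replicate 3 (.square K 5 (by simp)) ++ List.replicate 1 (.square K 4 (by simp))) (by simp) fun X hX => by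
    simp
    omega

lemma bounded_280 {r : ℕ} (hr : 2 ≤ r) : Bounded K 280 12 r :=
  bounded_of_stack (List.replicate 3 (.square K 7 (by simp)) ++ List.replicate 3 (.square K 6 (by simp)) ++ List.replicate 1 (.square K 5 (by simp))) (by simp) fun X hX => by
    simp
    omega

lemma bounded_439 {r : ℕ} (hr : 2 ≤ r) : Bounded K 439 14 r :=
  bounded_of_stack (List.replicate 4 (.square K 8 (by simp)) ++ List.replicate 3 (.square K 7 (by simp)) ++ List.replicate 1 (.square K 6 (by simp))) (by simp) fun X hX => by
    simp
    omega

lemma bounded_629 {r : ℕ} (hr : 2 ≤ r) : Bounded K 629 16 r :=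
  bounded_of_stack (List.replicate 4 (.square K 9 (by simp)) ++ List.replicate 4 (.square K 8 (by simp)) ++ List.replicate 1 (.square K 7 (by simp))) (by simp) fun X hX => by
    simp
    omega

lemma bounded_869 {r : ℕ} (hr : 2 ≤ r) : Bounded K 869 18 r :=
  bounded_of_stack (List.replicate 4 (.square K 10 (by simp)) ++ List.replicate 5 (.square K 9 (by simp)) ++ List.replicate 1 (.square K 8 (by simp))) (by simp) fun X hX => by
    simp
    omega

end Layers

section Certificates

variable {K : Type} [Field K] [CharZero K]

/-- Certificates for `NoPoly`: divide repeatedly by equations `xᵢ = c + ∑ aⱼ xⱼ`. -/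
inductive Cert : ℕ → Type
  | big {N : ℕ} : Cert N
  | line : Cert 1
  | div {N : ℕ} (i : Fin (N + 1)) (a : Fin N → ℤ) (c : ℤ) (restr : Cert N)
      (rest : Cert (N + 1)) : Cert (N + 1)

/-- Whether a point lies on the graph `xᵢ = c + ∑ aⱼ xⱼ`. -/
def onGraph {N : ℕ} (i : Fin (N + 1)) (a : Fin N → ℤ) (c : ℤ) (p : Fin (N + 1) → ℤ) : Bool :=
  decide (p i = c + (List.ofFn fun j => a j * p (i.succAbove j)).sum)

/-- The verification of a certificate. -/
def Cert.check : {N : ℕ} → Cert N → ℕ → List ((Fin N → ℤ) × ℕ) → Bool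
  | _, .big, D, l => l.any fun e => decide (D < e.2)
  | _, .line, D, l => decide ((l.map fun e => e.1 0).Nodup) && decide (D < (l.map Prod.snd).sum)
  | _, .div i a c s t, D, l =>
    s.check D ((l.filter fun e => onGraph i a c e.1).map fun e => (i.removeNth e.1, e.2)) &&
    (D == 0 || t.check (D - 1) (l.map fun e => (e.1, if onGraph i a c e.1 then e.2 - 1 else e.2)))

omit [CharZero K] in
lemma onGraph_iff {N : ℕ} {i : Fin (N + 1)} {a : Fin N → ℤ} {c : ℤ} {p : Fin (N + 1) → ℤ} :
    onGraph i a c p = true ↔ p i = c + ∑ j, a j * p (i.succAbove j) := by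
  rw [onGraph, decide_eq_true_iff, List.sum_ofFn]

lemma noPoly_of_graphs {N D : ℕ} {l l' : List ((Fin (N + 1) → ℤ) × ℕ)}
    {r : List ((Fin N → ℤ) × ℕ)} (i : Fin (N + 1)) (a : Fin N → ℤ) (c : ℤ)
    (hr : ∀ e ∈ r, ∃ e' ∈ l, onGraph i a c e'.1 ∧ i.removeNth e'.1 = e.1 ∧ e'.2 = e.2)
    (hl : ∀ e ∈ l', ∃ e' ∈ l, e'.1 = e.1 ∧ e.2 = if onGraph i a c e.1 then e'.2 - 1 else e'.2)
    (h1 : NoPoly K D r) (h2 : D = 0 ∨ NoPoly K (D - 1) l') : NoPoly K D l := by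
  intro f hf hv
  by_contra hf0
  have h0 : graphRestrict K i a c f = 0 := by
    refine h1 _ ((totalDegree_graphRestrict_le _ _ _ f).trans hf) fun e he => ?_
    obtain ⟨e', he', hp, h1, h2⟩ := hr e he
    rw [← h1, ← h2]
    exact (hv e' he').graphRestrict (onGraph_iff.mp hp)
  obtain ⟨g, hg, hd, hgv⟩ := exists_quotient_of_graphRestrict_eq_zero h0 hf0
  rcases h2 with rfl | h2
  · omega
  · refine hg (h2 g (by omega) fun e he => ?_)
    obtain ⟨e', he', h1, h2⟩ := hl e he
    have := hgv _ _ (hv e' he')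
    rw [h2, ← h1]
    simpa [onGraph_iff] using this

lemma noPoly_line (D : ℕ) (l : List ((Fin 1 → ℤ) × ℕ)) (hl : (l.map fun e => e.1 0).Nodup)
    (hD : D < (l.map Prod.snd).sum) : NoPoly K D l := by
  induction D using Nat.strong_induction_on generalizing l with
  | _ D ih =>
  obtain ⟨e, he, h0⟩ : ∃ e ∈ l, 0 < e.2 := by
    by_contra! H
    have : (l.map Prod.snd).sum = 0 := List.sum_eq_zero fun x hx => by
      obtain ⟨e, he, rfl⟩ := List.mem_map.mp hx
      simpa using H e he
    omega
  refine noPoly_of_graphs 0 0 (e.1 0) (r := [(Fin.elim0, e.2)])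
    (l' := l.map fun e' => (e'.1, if onGraph 0 0 (e.1 0) e'.1 then e'.2 - 1 else e'.2)) ?_ ?_ ?_ ?_
  · simp only [List.mem_singleton, forall_eq]
    exact ⟨e, he, onGraph_iff.mpr (by simp), Subsingleton.elim _ _, rfl⟩
  · intro e' he'
    obtain ⟨e'', h, rfl⟩ := List.mem_map.mp he'
    exact ⟨e'', h, rfl, rfl⟩
  · intro f hf hv
    exact eq_zero_of_vanishesTo (D := 0) (by rw [eq_C_of_isEmpty f, totalDegree_C]) h0
      (hv (Fin.elim0, e.2) (by simp))
  · rcases Nat.eq_zero_or_pos D with rfl | hpos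
    · exact .inl rfl
    · refine .inr (ih _ (by omega) _ (by simpa [Function.comp_def] using hl) ?_)
      obtain ⟨s, t, rfl⟩ := List.append_of_mem he
      have hs : ∀ e' ∈ s ++ t, e'.1 0 ≠ e.1 0 := by
        rw [(List.perm_middle.map _).nodup_iff, List.map_cons, List.nodup_cons] at hl
        intro e' he' h
        exact hl.1 (List.mem_map.mpr ⟨e', he', h⟩)
      have hmap : ∀ u : List ((Fin 1 → ℤ) × ℕ), (∀ e' ∈ u, e'.1 0 ≠ e.1 0) →
          (u.map fun e' => if onGraph 0 0 (e.1 0) e'.1 then e'.2 - 1 else e'.2) =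
            u.map Prod.snd := by
        intro u hu
        refine List.map_congr_left fun e' he' => if_neg ?_
        rw [onGraph_iff]
        simpa using hu e' he'
      have he1 : onGraph 0 0 (e.1 0) e.1 = true := onGraph_iff.mpr (by simp)
      simp only [List.map_map, Function.comp_def, List.map_append, List.map_cons, List.sum_append,
        List.sum_cons, he1, if_true] at hD ⊢
      rw [hmap s fun e' h => hs e' (List.mem_append_left _ h),
        hmap t fun e' h => hs e' (List.mem_append_right _ h)]
      omega

lemma Cert.noPoly {N : ℕ} (s : Cert N) {D : ℕ} {l : List ((Fin N → ℤ) × ℕ)}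
    (h : s.check D l = true) : NoPoly K D l := by
  induction s generalizing D with
  | big =>
    rw [check, List.any_eq_true] at h
    obtain ⟨e, he, h⟩ := h
    exact fun f hf hv => eq_zero_of_vanishesTo hf (of_decide_eq_true h) (hv e he)
  | line =>
    rw [check, Bool.and_eq_true] at h
    exact noPoly_line D l (of_decide_eq_true h.1) (of_decide_eq_true h.2)
  | div i a c s t hs ht =>
    rw [check, Bool.and_eq_true, Bool.or_eq_true, beq_iff_eq] at h
    refine noPoly_of_graphs i a c ?_ ?_ (hs h.1) (h.2.imp_right ht)
    · intro e he
      obtain ⟨e', he', rfl⟩ := List.mem_map.mp he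
      rw [List.mem_filter] at he'
      exact ⟨e', he'.1, he'.2, rfl, rfl⟩
    · intro e he
      obtain ⟨e', he', rfl⟩ := List.mem_map.mp he
      exact ⟨e', he', rfl, rfl⟩

lemma bounded_seven_two : Bounded K 7 3 2 :=
  ⟨[![0, 0, 0], ![0, 0, 1], ![0, 1, 0], ![0, 1, 1], ![1, 0, 0], ![1, 0, 1], ![1, 1, 0]], le_rfl, Cert.noPoly (D := 7)
    (
      .div 2 ![0, 0] 0 (.div 1 ![0] 0 .line <| .div 1 ![0] 1 .line <| .div 1 ![0] 0 .line <|
      .div 1 ![0] 1 .line <| .div 1 ![0] 0 .line <| .div 1 ![0] 1 .line <| .div 1 ![0] 0 .line <|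
      .big) <| .div 1 ![0, -1] 1 (.div 1 ![0] 1 .line <| .div 1 ![0] 0 .line <|
      .div 1 ![0] 1 .line <| .div 1 ![0] 0 .line <| .div 1 ![0] 1 .line <| .div 1 ![0] 0 .line <|
      .big) <| .div 0 ![0, -1] 1 (.div 1 ![0] 1 .line <| .div 0 ![1] 0 .line <|
      .div 1 ![0] 0 .line <| .div 1 ![0] 1 .line <| .div 1 ![0] 0 .line <| .big) <|
      .div 1 ![0, 0] 0 (.div 0 ![1] 0 .line <| .div 1 ![0] 0 .line <| .div 1 ![0] 1 .line <|
      .div 1 ![0] 0 .line <| .big) <| .div 0 ![-1, 1] 0 (.div 1 ![0] 1 .line <|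
      .div 0 ![1] 0 .line <| .div 1 ![0] 1 .line <| .big) <|
      .div 2 ![0, 0] 0 (.div 1 ![0] 1 .line <| .div 1 ![0] 0 .line <| .big) <| .big)
    (by decide)⟩

lemma bounded_fifteen_two : Bounded K 15 4 2 :=
  ⟨[![0, 0, 2], ![0, 1, 1], ![0, 2, 0], ![1, 0, 1], ![1, 0, 2], ![1, 1, 2], ![1, 2, 0], ![1,
    2, 1], ![1, 2, 2], ![2, 0, 0], ![2, 0, 1], ![2, 1, 2], ![2, 2, 0], ![2, 2, 1], ![2, 2, 2]], le_rfl, Cert.noPoly (D := 9)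
    (
      .div 1 ![0, 0] 2 (.div 1 ![0] 0 .line <| .div 0 ![1] 0 .line <| .div 0 ![0] 1 .line <|
      .div 0 ![0] 2 .line <| .div 0 ![0] 1 .line <| .div 0 ![0] 2 .line <| .div 1 ![0] 0 .line <|
      .div 0 ![-1] 3 .line <| .div 0 ![1] 0 .line <| .big) <|
      .div 2 ![0, 0] 2 (.div 0 ![1] 0 .line <| .div 0 ![0] 1 .line <| .div 0 ![2] 0 .line <|
      .div 0 ![0] 1 .line <| .div 0 ![2] 0 .line <| .div 0 ![1] 0 .line <| .div 0 ![1] 1 .line <|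
      .div 1 ![0] 2 .line <| .big) <| .div 0 ![0, 0] 2 (.div 0 ![0] 0 .line <|
      .div 0 ![0] 2 .line <| .div 0 ![1] (-1) .line <| .div 1 ![0] 0 .line <|
      .div 1 ![0] 1 .line <| .div 1 ![2] 0 .line <| .div 0 ![0] 2 .line <| .big) <|
      .div 0 ![0, 0] 1 (.div 1 ![0] 2 .line <| .div 1 ![0] 1 .line <| .div 0 ![0] 2 .line <|
      .div 0 ![1] (-1) .line <| .div 0 ![0] 0 .line <| .big) <|
      .div 1 ![0, 0] 0 (.div 0 ![-1] 2 .line <| .div 0 ![-1] 2 .line <| .div 0 ![-1] 3 .line <|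
      .div 1 ![0] 1 .line <| .div 1 ![0] 2 .line <| .big) <|
      .div 1 ![0, 0] 2 (.div 1 ![0] 0 .line <| .div 0 ![1] 0 .line <| .div 1 ![0] 0 .line <|
      .big) <| .big)
    (by decide)⟩

end Certificates

section GenericForms

variable {K : Type} [Field K] {n : ℕ}

instance (N δ : ℕ) : Finite {α : Fin N →₀ ℕ // α.degree < δ} :=
  (Finsupp.finite_of_degree_lt δ).to_subtype

noncomputable instance (N δ : ℕ) : Fintype {α : Fin N →₀ ℕ // α.degree < δ} :=
  Fintype.ofFinite _

noncomputable instance (N δ : ℕ) : Fintype (Expo (Fin N) δ) :=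
  Fintype.ofFinite _

/-- The form with given coefficients. -/
def formOf {D : ℕ} (c : Expo (Fin 4) D → K) : MvPolynomial (Fin 4) K :=
  ∑ α, monomial α.1 (c α)

lemma formOf_isHomogeneous {D : ℕ} (c : Expo (Fin 4) D → K) : (formOf c).IsHomogeneous D :=
  IsHomogeneous.sum _ _ _ fun α _ => isHomogeneous_monomial _ α.2

lemma coeff_formOf {D : ℕ} (c : Expo (Fin 4) D → K) (α : Expo (Fin 4) D) :
    coeff α.1 (formOf c) = c α := by
  classical
  rw [formOf, coeff_sum, Finset.sum_eq_single α]
  · simp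
  · intro β _ h
    rw [coeff_monomial, if_neg (fun h' => h (Subtype.ext h'))]
  · simp

lemma formOf_coeff {D : ℕ} {F : MvPolynomial (Fin 4) K} (hF : F.IsHomogeneous D) :
    formOf (fun α : Expo (Fin 4) D => coeff α.1 F) = F := by
  ext x
  by_cases hx : x.degree = D
  · exact coeff_formOf _ ⟨x, hx⟩
  · rw [(formOf_isHomogeneous _).coeff_eq_zero hx, hF.coeff_eq_zero hx]

/-- The translation of the affine space `K⁴` moving the origin to `w`. -/
def shift (w : Fin 4 → K) : MvPolynomial (Fin 4) K →ₐ[K] MvPolynomial (Fin 4) K :=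
  aeval fun i => X i + C (w i)

lemma constantCoeff_shift (w : Fin 4 → K) (F : MvPolynomial (Fin 4) K) :
    constantCoeff (shift w F) = eval w F := by
  have : (constantCoeff (R := K)).comp (shift w).toRingHom = eval w := by
    ext <;> simp [shift]
  exact DFunLike.congr_fun this F

lemma shift_mem_of_mem {w : Fin 4 → K} {m : ℕ} {F : MvPolynomial (Fin 4) K}
    (hF : F ∈ pointIdeal K w ^ m) : shift w F ∈ irrIdeal K ^ m := by
  have h1 := Ideal.mem_map_of_mem (shift w) hF
  rw [Ideal.map_pow] at h1
  refine Ideal.pow_right_mono ?_ m h1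
  rw [pointIdeal, Ideal.map_span, Ideal.span_le]
  rintro _ ⟨f, hf, rfl⟩
  rw [SetLike.mem_coe, irrIdeal_eq, ← pow_one (idealOfVars _ K), mem_pow_idealOfVars_iff']
  intro x hx
  rw [(Finsupp.degree_eq_zero_iff x).mp (by omega)]
  exact (constantCoeff_shift w f).trans hf.2

/-- Dehomogenisation with respect to `x₀`. -/
def dehomogenize : MvPolynomial (Fin 4) K →ₐ[K] MvPolynomial (Fin 3) K :=
  aeval (Fin.cons 1 X)

lemma eval_dehomogenize (F : MvPolynomial (Fin 4) K) (u : Fin 3 → K) :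
    eval u (dehomogenize F) = eval (Fin.cons 1 u : Fin 4 → K) F := by
  have : (eval u).comp (dehomogenize (K := K) : MvPolynomial (Fin 4) K →+* _) =
      eval (Fin.cons 1 u : Fin 4 → K) := by
    ext i
    · simp [dehomogenize]
    · refine Fin.cases ?_ (fun j => ?_) i <;> simp [dehomogenize]
  exact DFunLike.congr_fun this F

lemma eval_eq_pow_mul_eval_dehomogenize {F : MvPolynomial (Fin 4) K} {D : ℕ}
    (hF : F.IsHomogeneous D) {u : Fin 4 → K} (hu : u 0 ≠ 0) :
    eval u F = u 0 ^ D * eval (fun i => u i.succ / u 0) (dehomogenize F) := by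
  have h := congrArg (eval fun _ => u 0) (aeval_smul_X_zero hF (fun i => u i / u 0))
  have e : (eval fun _ => u 0).comp (aeval (fun i => C (u i / u 0) * X 0 :
      Fin 4 → MvPolynomial (Fin 4) K) : MvPolynomial (Fin 4) K →ₐ[K] _).toRingHom = eval u := by
    ext i
    · simp
    · simp [div_mul_cancel₀ _ hu]
  have e' : (Fin.cons 1 fun i : Fin 3 => u i.succ / u 0 : Fin 4 → K) = fun i => u i / u 0 := by
    funext i
    refine Fin.cases ?_ (fun j => ?_) i <;> simp [hu]
  rw [eval_dehomogenize, e', ← DFunLike.congr_fun e F, mul_comm]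
  simpa using h

lemma eq_zero_of_dehomogenize_eq_zero [CharZero K] {F : MvPolynomial (Fin 4) K} {D : ℕ}
    (hF : F.IsHomogeneous D) (h : dehomogenize F = 0) : F = 0 := by
  suffices h : F * X 0 = 0 from (mul_eq_zero.mp h).resolve_right (X_ne_zero 0)
  refine MvPolynomial.funext fun u => ?_
  rw [map_mul, eval_X, map_zero]
  by_cases hu : u 0 = 0
  · rw [hu, mul_zero]
  · rw [eval_eq_pow_mul_eval_dehomogenize hF hu, h, map_zero, mul_zero, zero_mul]

/-- The point of `ℙ³` with affine coordinates `p`. -/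
def homogenizePoint (K : Type) [Field K] (p : Fin 3 → ℤ) : Fin 4 → K :=
  Fin.cons 1 fun i => (p i : K)

lemma translateHom_dehomogenize (p : Fin 3 → ℤ) (F : MvPolynomial (Fin 4) K) :
    translateHom K p (dehomogenize F) = dropZero (shift (homogenizePoint K p) F) := by
  have : (translateHom K p).comp dehomogenize =
      dropZero.comp (shift (homogenizePoint K p)) := by
    ext i : 1
    refine Fin.cases ?_ (fun j => ?_) i <;>
      simp [translateHom, dehomogenize, shift, homogenizePoint]
  exact DFunLike.congr_fun this F

lemma vanishesTo_dehomogenize {p : Fin 3 → ℤ} {m : ℕ} {F : MvPolynomial (Fin 4) K}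
    (h : shift (homogenizePoint K p) F ∈ irrIdeal K ^ m) : VanishesTo (dehomogenize F) p m := by
  rw [VanishesTo, translateHom_dehomogenize, ← map_dropZero_irrIdeal_pow]
  exact Ideal.mem_map_of_mem _ h

/-- The matrix of the Taylor coefficients of order less than `m` at the `n` points of the forms
of degree `D`. -/
def taylorMatrix (K : Type) [Field K] (n m D : ℕ) :
    Matrix (Fin n × {s : Fin 4 →₀ ℕ // s.degree < m}) (Expo (Fin 4) D)
      (MvPolynomial (Fin n × Fin 4) K) :=
  fun js α => coeff js.2.1 (∏ i, (X i + C (X (js.1, i))) ^ α.1 i)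

lemma specMatrix_taylorMatrix_mulVec {m D : ℕ} (v : Fin n → Fin 4 → K)
    (c : Expo (Fin 4) D → K) (j : Fin n) (s : {s : Fin 4 →₀ ℕ // s.degree < m}) :
    (specMatrix (taylorMatrix K n m D) v).mulVec c (j, s) =
      coeff s.1 (shift (v j) (formOf c)) := by
  rw [formOf, map_sum, coeff_sum, Matrix.mulVec, dotProduct]
  refine Finset.sum_congr rfl fun α _ => ?_
  rw [specMatrix, Matrix.map_apply, taylorMatrix, ← coeff_map, shift, aeval_monomial,
    algebraMap_eq, coeff_C_mul, mul_comm, Finsupp.prod_fintype _ _ fun _ => pow_zero _]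
  simp

lemma generic_noForm [CharZero K] {m D : ℕ} {l : List (Fin 3 → ℤ)} (hn : l.length ≤ n)
    (h : NoPoly K D (fat l m)) : Generic fun v : Fin n → Fin 4 → K => NoForm v m D := by
  have h0 : ∀ c, (specMatrix (taylorMatrix K n m D)
      fun j => homogenizePoint K (l.getD j 0)).mulVec c = 0 → c = 0 := by
    intro c hc
    have hF : formOf c = 0 := by
      refine eq_zero_of_dehomogenize_eq_zero (formOf_isHomogeneous c) (h _ ?_ ?_)
      · refine (totalDegree_aeval_le_of_forall_le_one (fun i => ?_) _).trans
          (formOf_isHomogeneous c).totalDegree_le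
        refine Fin.cases ?_ (fun j => ?_) i <;> simp
      · rw [forall_mem_fat]
        intro p hp
        obtain ⟨j, hj, rfl⟩ := List.getElem_of_mem hp
        refine vanishesTo_dehomogenize ?_
        rw [irrIdeal_eq, mem_pow_idealOfVars_iff']
        intro s hs
        have := congrFun hc (⟨j, by omega⟩, ⟨s, hs⟩)
        rw [specMatrix_taylorMatrix_mulVec] at this
        simpa [hj] using this
    funext α
    rw [← coeff_formOf c α, hF, coeff_zero, Pi.zero_apply]
  classical
  refine (generic_injective _ h0).mono fun v hv F hF hFv => ?_
  rw [← formOf_coeff hF] at hFv ⊢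
  have hc : (fun α : Expo (Fin 4) D => coeff α.1 F) = 0 := by
    refine hv _ (funext fun js => ?_)
    rw [specMatrix_taylorMatrix_mulVec]
    have := shift_mem_of_mem ((Ideal.mem_iInf.mp hFv) js.1)
    rw [irrIdeal_eq, mem_pow_idealOfVars_iff'] at this
    exact this _ js.2.2
  rw [hc]
  simp [formOf]

end GenericForms

section Lattice

variable {K : Type} [Field K]

/-- The point of `ℙ³` with affine coordinates the natural numbers `μ i`. -/
def latticePoint (K : Type) [Field K] (μ : Fin 3 → ℕ) : Fin 4 → K :=
  Fin.cons 1 fun i => (μ i : K)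

/-- The form of degree `d` distracting the monomial `x₀^(d - |lam|) x^lam`. -/
def distraction (K : Type) [Field K] (lam : Fin 3 → ℕ) (d : ℕ) : MvPolynomial (Fin 4) K :=
  X 0 ^ (d - ∑ i, lam i) * ∏ i, ∏ a ∈ Finset.range (lam i), (X i.succ - C (a : K) * X 0)

lemma distraction_isHomogeneous {lam : Fin 3 → ℕ} {d : ℕ} (h : ∑ i, lam i ≤ d) :
    (distraction K lam d).IsHomogeneous d := by
  have h1 : (∏ i, ∏ a ∈ Finset.range (lam i),
      (X i.succ - C (a : K) * X 0 : MvPolynomial (Fin 4) K)).IsHomogeneous (∑ i, lam i) := by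
    refine IsHomogeneous.prod _ _ _ fun i _ => ?_
    have := IsHomogeneous.prod (Finset.range (lam i))
      (fun a => (X i.succ - C (a : K) * X 0 : MvPolynomial (Fin 4) K)) (fun _ => 1)
      fun a _ => (isHomogeneous_X _ _).sub (isHomogeneous_C_mul_X _ _)
    simpa using this
  have h2 := ((isHomogeneous_X K (0 : Fin 4)).pow (d - ∑ i, lam i)).mul h1
  rwa [one_mul, Nat.sub_add_cancel h] at h2

lemma eval_distraction (lam μ : Fin 3 → ℕ) (d : ℕ) :
    eval (latticePoint K μ) (distraction K lam d) =
      ∏ i, ∏ a ∈ Finset.range (lam i), ((μ i : K) - a) := by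
  simp [distraction, latticePoint]

lemma eval_distraction_eq_zero {lam μ : Fin 3 → ℕ} (h : ¬ lam ≤ μ) (d : ℕ) :
    eval (latticePoint K μ) (distraction K lam d) = 0 := by
  rw [eval_distraction]
  obtain ⟨i, hi⟩ := not_forall.mp h
  exact Finset.prod_eq_zero (Finset.mem_univ i)
    (Finset.prod_eq_zero (Finset.mem_range.mpr (not_le.mp hi)) (sub_self _))

lemma eval_distraction_self [CharZero K] (lam : Fin 3 → ℕ) (d : ℕ) :
    eval (latticePoint K lam) (distraction K lam d) ≠ 0 := by
  rw [eval_distraction]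
  refine Finset.prod_ne_zero_iff.mpr fun i _ => Finset.prod_ne_zero_iff.mpr fun a ha => ?_
  exact sub_ne_zero.mpr (Nat.cast_injective.ne (Finset.mem_range.mp ha).ne')

lemma dropZero_distraction (lam : Fin 3 → ℕ) :
    dropZero (distraction K lam (∑ i, lam i)) = ∏ i, X i ^ lam i := by
  simp [distraction, map_prod]

lemma exists_interpolation [CharZero K] {d : ℕ} (S : Finset (Fin 3 → ℕ))
    (hS : ∀ μ ∈ S, ∑ i, μ i ≤ d) (w : (Fin 3 → ℕ) → K) :
    ∃ F : MvPolynomial (Fin 4) K, F.IsHomogeneous d ∧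
      ∀ μ ∈ S, eval (latticePoint K μ) F = w μ := by
  classical
  induction S using Finset.induction_on_max_value (fun μ : Fin 3 → ℕ => ∑ i, μ i) with
  | empty => exact ⟨0, isHomogeneous_zero _ _ _, by simp⟩
  | insert lam S hlam hmax ih =>
    obtain ⟨F, hF, h⟩ := ih fun μ hμ => hS μ (Finset.mem_insert_of_mem hμ)
    refine ⟨F + C ((w lam - eval (latticePoint K lam) F) /
      eval (latticePoint K lam) (distraction K lam d)) * distraction K lam d,
      hF.add ((distraction_isHomogeneous (hS lam (Finset.mem_insert_self _ _))).C_mul _), ?_⟩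
    intro μ hμ
    rw [map_add, map_mul, eval_C]
    rcases Finset.mem_insert.mp hμ with rfl | hμ
    · rw [div_mul_cancel₀ _ (eval_distraction_self μ d), add_sub_cancel]
    · suffices hle : ¬ lam ≤ μ by
        rw [h μ hμ, eval_distraction_eq_zero hle, mul_zero, add_zero]
      intro hle
      have h1 := Finset.sum_eq_sum_iff_of_le (s := Finset.univ) (fun i _ => hle i)
      have h2 := h1.mp (le_antisymm (Finset.sum_le_sum fun i _ => hle i) (hmax μ hμ))
      have : lam = μ := funext fun i => h2 i (Finset.mem_univ i)
      exact hlam (this ▸ hμ)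

/-- The lattice points of the simplex of size `d`. -/
def simplex (d : ℕ) : Finset (Fin 3 → ℕ) :=
  ((Finset.univ : Finset (Fin 4)).finsuppAntidiag d).image fun α i => α i.succ

lemma mem_simplex {d : ℕ} {μ : Fin 3 → ℕ} : μ ∈ simplex d ↔ ∑ i, μ i ≤ d := by
  simp only [simplex, Finset.mem_image, Finset.mem_finsuppAntidiag, Finset.subset_univ, and_true]
  constructor
  · rintro ⟨α, h, rfl⟩
    rw [Fin.sum_univ_succ] at h
    show ∑ i : Fin 3, α i.succ ≤ d
    omega
  · intro h
    refine ⟨Finsupp.equivFunOnFinite.symm (Fin.cons (d - ∑ i, μ i) μ), ?_, ?_⟩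
    · simp only [Finsupp.equivFunOnFinite_symm_apply_apply]
      rw [Fin.sum_univ_succ]
      simp only [Fin.cons_zero, Fin.cons_succ]
      omega
    · simp

lemma card_simplex (d : ℕ) : (simplex d).card = (d + 3).choose 3 := by
  rw [simplex, Finset.card_image_of_injOn, Finset.card_finsuppAntidiag_nat_eq_choose]
  · rw [Finset.card_univ, Fintype.card_fin, show 4 + d - 1 = d + 3 by omega,
      ← Nat.choose_symm_add]
  · intro α hα β hβ h
    simp only [Finset.mem_coe, Finset.mem_finsuppAntidiag, Fin.sum_univ_succ (n := 3)] at hα hβ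
    have h' : ∀ i : Fin 3, α i.succ = β i.succ := fun i => congrFun h i
    ext i
    refine Fin.cases ?_ h' i
    have := hα.1
    have := hβ.1
    simp only [h'] at *
    omega

/-- Every monomial of degree `d + 1` in three variables is a multiple of a monomial of degree `d`
not in `T`. -/
def Avoids (T : Finset (Fin 3 → ℕ)) (d : ℕ) : Prop :=
  ∀ α : Fin 3 → ℕ, ∑ i, α i = d + 1 → ∃ i, 1 ≤ α i ∧ α - Pi.single i 1 ∉ T

lemma exists_vanishing_syzygy_monomial {T : Finset (Fin 3 → ℕ)} {d : ℕ} (hT : Avoids T d)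
    (α : Expo (Fin 4) (d + 1)) (c : K) : ∃ r : Fin 3 → MvPolynomial (Fin 4) K,
      (∀ i, (r i).IsHomogeneous d) ∧
      (∀ i, ∀ μ, (∑ i, μ i < d ∨ ∑ i, μ i = d ∧ μ ∈ T) → eval (latticePoint K μ) (r i) = 0) ∧
      dropZero (monomial α.1 c - ∑ i, X i.succ * r i) = 0 := by
  have hm : monomial α.1 c = C c * (X 0 ^ α.1 0 * ∏ i : Fin 3, X i.succ ^ α.1 i.succ) := by
    rw [monomial_eq, Finsupp.prod_fintype _ _ fun _ => pow_zero _, Fin.prod_univ_succ]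
  by_cases h0 : α.1 0 = 0
  · have hdeg : ∑ i : Fin 3, α.1 i.succ = d + 1 := by
      have := α.2
      rw [Finsupp.degree_eq_sum, Fin.sum_univ_succ, h0, zero_add] at this
      exact this
    obtain ⟨i, hi, hiT⟩ := hT (fun i => α.1 i.succ) hdeg
    set β : Fin 3 → ℕ := (fun i => α.1 i.succ) - Pi.single i 1 with hβ
    have hβ' : β + Pi.single i 1 = fun i => α.1 i.succ := by
      refine tsub_add_cancel_of_le fun k => ?_
      rcases eq_or_ne k i with rfl | hk
      · simpa using hi
      · simp [hk]
    have hsum : ∑ k, β k = d := by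
      have := congrArg (fun f : Fin 3 → ℕ => ∑ k, f k) hβ'
      simp only [Pi.add_apply, Finset.sum_add_distrib, hdeg, Finset.sum_pi_single',
        Finset.mem_univ, if_true] at this
      simpa using this
    refine ⟨Pi.single i (C c * distraction K β d), fun k => ?_, fun k μ hμ => ?_, ?_⟩
    · rcases eq_or_ne k i with rfl | hk
      · simpa using (distraction_isHomogeneous (K := K) hsum.le).C_mul c
      · simpa [hk] using isHomogeneous_zero _ _ _
    · rcases eq_or_ne k i with rfl | hk
      · rw [Pi.single_eq_same, map_mul, eval_distraction_eq_zero, mul_zero]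
        intro hle
        have hs := Finset.sum_le_sum fun i (_ : i ∈ Finset.univ) => hle i
        rcases hμ with hμ | ⟨hμ, hμT⟩
        · omega
        · have h1 := Finset.sum_eq_sum_iff_of_le (s := Finset.univ) (fun i _ => hle i)
          have h2 := h1.mp (hsum.trans hμ.symm)
          have : β = μ := funext fun i => h2 i (Finset.mem_univ i)
          exact hiT (this ▸ hμT)
      · simp [hk]
    · have h1 : ∀ k : Fin 3, α.1 k.succ = β k + (Pi.single i 1 : Fin 3 → ℕ) k :=
        fun k => (congrFun hβ' k).symm
      have h2 : dropZero (distraction K β d) = ∏ i, X i ^ β i := by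
        rw [← hsum, dropZero_distraction]
      have h3 : ∏ k : Fin 3, (X k : MvPolynomial (Fin 3) K) ^ (Pi.single i 1 : Fin 3 → ℕ) k =
          X i := by
        rw [Finset.prod_eq_single i]
        · simp
        · intro k _ hk
          simp [hk]
        · simp
      have h5 (k : Fin 3) : dropZero (X k.succ : MvPolynomial (Fin 4) K) = X k := by simp
      have h4 : dropZero (C c : MvPolynomial (Fin 4) K) = C c := dropZero.commutes c
      rw [Finset.sum_eq_single i]
      · rw [Pi.single_eq_same, hm, h0]
        simp only [map_sub, map_mul, h4, h2, map_prod, map_pow, h5, h1, pow_add,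
          Finset.prod_mul_distrib, h3, pow_zero, map_one]
        ring
      · intro k _ hk
        simp [hk]
      · simp
  · refine ⟨0, fun i => isHomogeneous_zero _ _ _, by simp, ?_⟩
    rw [hm]
    simp [h0]

lemma exists_vanishing_syzygy {T : Finset (Fin 3 → ℕ)} {d : ℕ} (hT : Avoids T d)
    {u : MvPolynomial (Fin 4) K} (hu : u.IsHomogeneous (d + 1)) :
    ∃ r : Fin 3 → MvPolynomial (Fin 4) K, (∀ i, (r i).IsHomogeneous d) ∧
      (∀ i, ∀ μ, (∑ i, μ i < d ∨ ∑ i, μ i = d ∧ μ ∈ T) → eval (latticePoint K μ) (r i) = 0) ∧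
      dropZero (u - ∑ i, X i.succ * r i) = 0 := by
  choose r hr hv hd using fun α : Expo (Fin 4) (d + 1) =>
    exists_vanishing_syzygy_monomial hT α (coeff α.1 u)
  refine ⟨fun i => ∑ α, r α i, fun i => IsHomogeneous.sum _ _ _ fun α _ => hr α i,
    fun i μ hμ => ?_, ?_⟩
  · rw [map_sum]
    exact Finset.sum_eq_zero fun α _ => hv α i μ hμ
  · have : u - ∑ i : Fin 3, X i.succ * ∑ α, r α i =
        ∑ α : Expo (Fin 4) (d + 1), (monomial α.1 (coeff α.1 u) - ∑ i, X i.succ * r α i) := by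
      rw [Finset.sum_sub_distrib, Finset.sum_comm]
      simp_rw [Finset.mul_sum]
      congr 1
      exact (formOf_coeff hu).symm
    rw [this, map_sum]
    exact Finset.sum_eq_zero fun α _ => hd α

end Lattice

section Surjectivity

variable {K : Type} [Field K] {n : ℕ}

/-- The matrix of the values at `n` points of the monomials of degree `d`. -/
def evalMatrix (K : Type) [Field K] (n d : ℕ) :
    Matrix (Fin n) (Expo (Fin 4) d) (MvPolynomial (Fin n × Fin 4) K) :=
  fun j α => ∏ i, X (j, i) ^ α.1 i

lemma sum_eval_evalMatrix_mul {d : ℕ} (v : Fin n → Fin 4 → K) (c : Expo (Fin 4) d → K)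
    (j : Fin n) :
    ∑ α, eval (fun q => v q.1 q.2) (evalMatrix K n d j α) * c α = eval (v j) (formOf c) := by
  rw [formOf, map_sum]
  refine Finset.sum_congr rfl fun α _ => ?_
  rw [eval_monomial, Finsupp.prod_fintype _ _ fun _ => pow_zero _, evalMatrix, mul_comm]
  simp

lemma evalMatrix_mulVec {d : ℕ} (v : Fin n → Fin 4 → K) (c : Expo (Fin 4) d → K) (j : Fin n) :
    (specMatrix (evalMatrix K n d) v).mulVec c j = eval (v j) (formOf c) := by
  rw [← sum_eval_evalMatrix_mul]
  rfl

lemma exists_injective_mem {S : Finset (Fin 3 → ℕ)} (h : n ≤ S.card) :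
    ∃ p : Fin n → Fin 3 → ℕ, Function.Injective p ∧ ∀ j, p j ∈ S := by
  refine ⟨fun j => S.equivFin.symm (Fin.castLE h j), fun i j hij => ?_, fun j => Subtype.coe_prop _⟩
  exact Fin.castLE_injective h (S.equivFin.symm.injective (Subtype.ext hij))

lemma exists_interpolation_of_injective [CharZero K] {d : ℕ} {p : Fin n → Fin 3 → ℕ}
    (hp : Function.Injective p) (hd : ∀ j, ∑ i, p j i ≤ d) (w : Fin n → K) :
    ∃ F : MvPolynomial (Fin 4) K, F.IsHomogeneous d ∧
      ∀ j, eval (latticePoint K (p j)) F = w j := by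
  classical
  obtain ⟨F, hF, h⟩ := exists_interpolation (K := K) (d := d) (Finset.univ.image p)
    (by simpa using hd) (Function.extend p w 0)
  exact ⟨F, hF, fun j => by
    rw [h _ (Finset.mem_image_of_mem _ (Finset.mem_univ j)), hp.extend_apply]⟩

lemma generic_separated [CharZero K] {d : ℕ} (h : n ≤ (d + 3).choose 3) :
    Generic fun v : Fin n → Fin 4 → K => Separated v d := by
  classical
  obtain ⟨p, hp, hpS⟩ := exists_injective_mem ((card_simplex d).symm ▸ h)
  refine (generic_surjective (evalMatrix K n d) (v₀ := fun j => latticePoint K (p j))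
    fun w => ?_).mono fun v hv => ?_
  · obtain ⟨F, hF, h⟩ := exists_interpolation_of_injective hp (fun j => mem_simplex.mp (hpS j)) w
    refine ⟨fun α => coeff α.1 F, funext fun j => ?_⟩
    rw [evalMatrix_mulVec, formOf_coeff hF, h j]
  · choose c hc using hv
    refine ⟨fun j => formOf (c fun i => if i = j then 1 else 0), fun j =>
      ⟨formOf_isHomogeneous _, fun i => ?_⟩⟩
    rw [← evalMatrix_mulVec, hc]

/-- Every form `u` of degree `d + 1` is a combination of the variables whose coefficients, apart
from that of `x₀`, have prescribed values at the given points. -/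
def Decomposes (v : Fin n → Fin 4 → K) (d : ℕ) : Prop :=
  ∀ u : MvPolynomial (Fin 4) K, u.IsHomogeneous (d + 1) → ∀ w : Fin 3 → Fin n → K,
    ∃ q : Fin 4 → MvPolynomial (Fin 4) K, (∀ i, (q i).IsHomogeneous d) ∧
      ∑ i, X i * q i = u ∧ ∀ i j, eval (v j) (q (Fin.succ i)) = w i j

lemma Decomposes.separated {v : Fin n → Fin 4 → K} {d : ℕ} (h : Decomposes v d) :
    Separated v d := by
  choose q hq _ hw using fun j : Fin n => h 0 (isHomogeneous_zero _ _ _)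
    fun _ i => if i = j then 1 else 0
  exact ⟨fun j => q j 1, fun j => ⟨hq j 1, fun i => hw j 0 i⟩⟩

lemma Decomposes.formsIdeal_le {v : Fin n → Fin 4 → K} {d : ℕ} (h : Decomposes v d)
    (hv : ∀ j, v j 0 ≠ 0) : formsIdeal v (d + 1) ≤ irrIdeal K * formsIdeal v d := by
  refine Ideal.span_le.mpr ?_
  rintro u ⟨hu, huv⟩
  obtain ⟨q, hq, rfl, hw⟩ := h u hu 0
  refine Ideal.sum_mem _ fun i _ => Ideal.mul_mem_mul (Ideal.subset_span ⟨i, rfl⟩)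
    (Ideal.subset_span ⟨hq i, fun j => ?_⟩)
  refine Fin.cases ?_ (fun i => hw i j) i
  have := huv j
  rw [Fin.sum_univ_succ, map_add, map_sum] at this
  simpa [hw, hv j] using this

lemma decomposes_latticePoint [CharZero K] {T : Finset (Fin 3 → ℕ)} {d : ℕ} (hT : Avoids T d)
    {p : Fin n → Fin 3 → ℕ} (hp : Function.Injective p)
    (h : ∀ j, ∑ i, p j i < d ∨ ∑ i, p j i = d ∧ p j ∈ T) :
    Decomposes (fun j => latticePoint K (p j)) d := by
  intro u hu w
  choose W hW hWw using fun i => exists_interpolation_of_injective (K := K) hp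
    (d := d) (fun j => (h j).elim le_of_lt fun h => h.1.le) (w i)
  have hX (f : Fin 3 → MvPolynomial (Fin 4) K) (hf : ∀ i, (f i).IsHomogeneous d) :
      (∑ i : Fin 3, X i.succ * f i).IsHomogeneous (d + 1) := by
    refine IsHomogeneous.sum _ _ _ fun i _ => ?_
    rw [add_comm d]
    exact (isHomogeneous_X _ _).mul (hf i)
  obtain ⟨r, hr, hrv, hd⟩ := exists_vanishing_syzygy hT (hu.sub (hX W hW))
  obtain ⟨q, hq⟩ := X_dvd_of_dropZero_eq_zero hd
  refine ⟨Fin.cons q (W + r), fun i => ?_, ?_, fun i j => ?_⟩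
  · refine Fin.cases ?_ (fun i => (hW i).add (hr i)) i
    refine isHomogeneous_of_X_mul ?_
    rw [Fin.cons_zero, ← hq]
    exact (hu.sub (hX W hW)).sub (hX r hr)
  · simp only [Fin.sum_univ_succ (n := 3), Fin.cons_zero, Fin.cons_succ, Pi.add_apply, mul_add,
      Finset.sum_add_distrib, ← hq]
    ring
  · rw [Fin.cons_succ, Pi.add_apply, map_add, hWw, hrv i _ (h j), add_zero]

/-- The matrix of the linear map sending `q` to the form `∑ xᵢ qᵢ` and the values of
`q₁, q₂, q₃` at the points. -/
def decompositionMatrix (K : Type) [Field K] (n d : ℕ) :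
    Matrix (Expo (Fin 4) (d + 1) ⊕ Fin 3 × Fin n) (Fin 4 × Expo (Fin 4) d)
      (MvPolynomial (Fin n × Fin 4) K) :=
  fun a kα => a.elim (fun β => C (coeff β.1 (X kα.1 * monomial kα.2.1 (1 : K))))
    fun ij => if kα.1 = ij.1.succ then evalMatrix K n d ij.2 kα.2 else 0

lemma decompositionMatrix_mulVec_inl {d : ℕ} (v : Fin n → Fin 4 → K)
    (c : Fin 4 × Expo (Fin 4) d → K) (β : Expo (Fin 4) (d + 1)) :
    (specMatrix (decompositionMatrix K n d) v).mulVec c (Sum.inl β) =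
      coeff β.1 (∑ i, X i * formOf fun α => c (i, α)) := by
  rw [Matrix.mulVec, dotProduct, Fintype.sum_prod_type, coeff_sum]
  refine Finset.sum_congr rfl fun i _ => ?_
  rw [formOf, Finset.mul_sum, coeff_sum]
  refine Finset.sum_congr rfl fun α _ => ?_
  have : monomial α.1 (c (i, α)) = C (c (i, α)) * monomial α.1 1 := by
    rw [C_mul_monomial, mul_one]
  rw [this, mul_left_comm, coeff_C_mul, mul_comm]
  simp [specMatrix, decompositionMatrix]

lemma decompositionMatrix_mulVec_inr {d : ℕ} (v : Fin n → Fin 4 → K)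
    (c : Fin 4 × Expo (Fin 4) d → K) (i : Fin 3) (j : Fin n) :
    (specMatrix (decompositionMatrix K n d) v).mulVec c (Sum.inr (i, j)) =
      eval (v j) (formOf fun α => c (i.succ, α)) := by
  rw [Matrix.mulVec, dotProduct, Fintype.sum_prod_type, Finset.sum_eq_single i.succ,
    ← sum_eval_evalMatrix_mul]
  · simp [specMatrix, decompositionMatrix]
  · intro k _ hk
    simp [specMatrix, decompositionMatrix, hk]
  · simp

lemma generic_decomposes [CharZero K] {T : Finset (Fin 3 → ℕ)} {d : ℕ} (hT : Avoids T d)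
    {p : Fin n → Fin 3 → ℕ} (hp : Function.Injective p)
    (h : ∀ j, ∑ i, p j i < d ∨ ∑ i, p j i = d ∧ p j ∈ T) :
    Generic fun v : Fin n → Fin 4 → K => Decomposes v d := by
  classical
  refine (generic_surjective (decompositionMatrix K n d) (v₀ := fun j => latticePoint K (p j))
    fun w => ?_).mono fun v hv => ?_
  · obtain ⟨q, hq, hu, hw⟩ := decomposes_latticePoint hT hp h _
      (formOf_isHomogeneous fun β => w (Sum.inl β)) fun i j => w (Sum.inr (i, j))
    refine ⟨fun iα => coeff iα.2.1 (q iα.1), funext fun a => ?_⟩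
    rcases a with β | ⟨i, j⟩
    · simp only [decompositionMatrix_mulVec_inl, formOf_coeff (hq _), hu, coeff_formOf]
    · simp only [decompositionMatrix_mulVec_inr, formOf_coeff (hq _), hw]
  · intro u hu w
    obtain ⟨c, hc⟩ := hv (Sum.elim (fun β => coeff β.1 u) fun ij => w ij.1 ij.2)
    refine ⟨fun i => formOf fun α => c (i, α), fun i => formOf_isHomogeneous _, ?_,
      fun i j => ?_⟩
    · have hs : (∑ i, X i * formOf fun α => c (i, α)).IsHomogeneous (d + 1) := by
        refine IsHomogeneous.sum _ _ _ fun i _ => ?_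
        rw [add_comm d]
        exact (isHomogeneous_X _ _).mul (formOf_isHomogeneous _)
      rw [← formOf_coeff hs, ← formOf_coeff hu]
      congr 1
      funext β
      rw [← decompositionMatrix_mulVec_inl v, hc, Sum.elim_inl]
    · rw [← decompositionMatrix_mulVec_inr, hc, Sum.elim_inr]

end Surjectivity

section Lists

variable {K : Type} [Field K] {n : ℕ}

lemma generic_decomposes_of_le [CharZero K] {T : Finset (Fin 3 → ℕ)} {d : ℕ}
    (hT : Avoids T (d + 1)) (hd : ∀ μ ∈ T, ∑ i, μ i = d + 1)
    (h : n ≤ (d + 3).choose 3 + T.card) :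
    Generic fun v : Fin n → Fin 4 → K => Decomposes v (d + 1) := by
  classical
  have hS : (simplex d ∪ T).card = (d + 3).choose 3 + T.card := by
    rw [Finset.card_union_of_disjoint, card_simplex]
    refine Finset.disjoint_left.mpr fun μ h1 h2 => ?_
    have := mem_simplex.mp h1
    have := hd μ h2
    omega
  obtain ⟨p, hp, hpS⟩ := exists_injective_mem (hS.symm ▸ h)
  refine generic_decomposes hT hp fun j => ?_
  rcases Finset.mem_union.mp (hpS j) with h | h
  · exact Or.inl (Nat.lt_succ_iff.mpr (mem_simplex.mp h))
  · exact Or.inr ⟨hd _ h, h⟩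

lemma avoids_of_forall {T : Finset (Fin 3 → ℕ)} {d : ℕ}
    (h : ∀ a ∈ Finset.range (d + 2), ∀ b ∈ Finset.range (d + 2 - a),
      1 ≤ a ∧ ![a - 1, b, d + 1 - a - b] ∉ T ∨ 1 ≤ b ∧ ![a, b - 1, d + 1 - a - b] ∉ T ∨
        1 ≤ d + 1 - a - b ∧ ![a, b, d + 1 - a - b - 1] ∉ T) : Avoids T d := by
  intro α hα
  rw [Fin.sum_univ_three] at hα
  have h2 : α 2 = d + 1 - α 0 - α 1 := by omega
  have e : α = ![α 0, α 1, d + 1 - α 0 - α 1] := by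
    funext i
    fin_cases i
    exacts [rfl, rfl, h2]
  have := h (α 0) (Finset.mem_range.mpr (by omega)) (α 1) (Finset.mem_range.mpr (by omega))
  rcases this with ⟨h, hT⟩ | ⟨h, hT⟩ | ⟨h, hT⟩
  · refine ⟨0, h, ?_⟩
    have : α - Pi.single 0 1 = ![α 0 - 1, α 1, d + 1 - α 0 - α 1] := by
      funext i
      fin_cases i <;> simp [h2]
    rwa [this]
  · refine ⟨1, h, ?_⟩
    have : α - Pi.single 1 1 = ![α 0, α 1 - 1, d + 1 - α 0 - α 1] := by
      funext i
      fin_cases i <;> simp [h2]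
    rwa [this]
  · refine ⟨2, h2 ▸ h, ?_⟩
    have : α - Pi.single 2 1 = ![α 0, α 1, d + 1 - α 0 - α 1 - 1] := by
      funext i
      fin_cases i <;> simp [h2]
    rwa [this]

lemma generic_decomposes_two [CharZero K] (h : n ≤ 6) :
    Generic fun v : Fin n → Fin 4 → K => Decomposes v 2 :=
  generic_decomposes_of_le (d := 1)
    (T := {![1, 0, 1], ![1, 1, 0]})
    (avoids_of_forall (by decide)) (by decide) (h.trans (by decide))

lemma generic_decomposes_three [CharZero K] (h : n ≤ 14) :
    Generic fun v : Fin n → Fin 4 → K => Decomposes v 3 :=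
  generic_decomposes_of_le (d := 2)
    (T := {![0, 2, 1], ![1, 0, 2], ![1, 1, 1], ![2, 1, 0]})
    (avoids_of_forall (by decide)) (by decide) (h.trans (by decide))

lemma generic_decomposes_four [CharZero K] (h : n ≤ 26) :
    Generic fun v : Fin n → Fin 4 → K => Decomposes v 4 :=
  generic_decomposes_of_le (d := 3)
    (T := {![0, 3, 1], ![1, 0, 3], ![1, 1, 2], ![1, 2, 1], ![2, 1, 1], ![3, 0, 1]})
    (avoids_of_forall (by decide)) (by decide) (h.trans (by decide))

lemma generic_decomposes_five [CharZero K] (h : n ≤ 44) :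
    Generic fun v : Fin n → Fin 4 → K => Decomposes v 5 :=
  generic_decomposes_of_le (d := 4)
    (T := {![0, 1, 4], ![0, 4, 1], ![1, 1, 3], ![1, 2, 2], ![2, 0, 3], ![2, 2, 1], ![2, 3, 0],
      ![3, 1, 1], ![4, 0, 1]})
    (avoids_of_forall (by decide)) (by decide) (h.trans (by decide))

lemma generic_decomposes_six [CharZero K] (h : n ≤ 63) :
    Generic fun v : Fin n → Fin 4 → K => Decomposes v 6 :=
  generic_decomposes_of_le (d := 5)
    (T := {![0, 2, 4], ![1, 0, 5], ![2, 2, 2], ![3, 0, 3], ![3, 1, 2], ![3, 3, 0], ![5, 0, 1]})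
    (avoids_of_forall (by decide)) (by decide) (h.trans (by decide))

lemma generic_decomposes_seven [CharZero K] (h : n ≤ 90) :
    Generic fun v : Fin n → Fin 4 → K => Decomposes v 7 :=
  generic_decomposes_of_le (d := 6)
    (T := {![1, 4, 2], ![2, 0, 5], ![2, 1, 4], ![3, 1, 3], ![4, 2, 1], ![6, 0, 1]})
    (avoids_of_forall (by decide)) (by decide) (h.trans (by decide))

end Lists

section Monomials

variable {A : Type} [CommRing A] {M I : Ideal A} {x y z t : A}

lemma mul_mem_pow_succ_mul {J : Ideal A} {k : ℕ} {p q : A} (hp : p ∈ M) (hq : q ∈ M ^ k * J) :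
    p * q ∈ M ^ (k + 1) * J := by
  rw [pow_succ', mul_assoc]
  exact Ideal.mul_mem_mul hp hq

lemma mul_mem_mul_pow_succ {J : Ideal A} {k : ℕ} {p q : A} (hp : p ∈ I) (hq : q ∈ J * I ^ k) :
    p * q ∈ J * I ^ (k + 1) := by
  rw [pow_succ', mul_left_comm]
  exact Ideal.mul_mem_mul hp hq

lemma mem_pow_mul_of_three_aux (hx : x ∈ M) (hy : y ∈ M) (hz : z ∈ M) (ht : t ∈ M) {r : ℕ}
    (h : ∀ a b c e : ℕ, 3 * r ≤ b + c + e + 2 → 3 * r ≤ a + c + e + 2 → 3 * r ≤ a + b + e + 2 →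
      x ^ a * y ^ b * z ^ c * t ^ e ∈ M ^ (2 * r - 2) * I ^ r) (u : ℕ) :
    ∀ a b c e : ℕ, 3 * r + u ≤ b + c + e + 2 → 3 * r + u ≤ a + c + e + 2 →
      3 * r + u ≤ a + b + e + 2 →
      x ^ a * y ^ b * z ^ c * t ^ e ∈ M ^ (2 * r + u - 2) * I ^ r := by
  induction u with
  | zero => exact h
  | succ u ih =>
    intro a b c e h0 h1 h2
    by_cases hr : 2 * r + u < 2
    · obtain rfl : r = 0 := by omega
      rw [show 2 * 0 + (u + 1) - 2 = 0 by omega]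
      simp
    rw [show 2 * r + (u + 1) - 2 = 2 * r + u - 2 + 1 by omega]
    have : 1 ≤ a ∨ 1 ≤ b ∨ 1 ≤ c ∨ 1 ≤ e := by omega
    rcases this with h | h | h | h
    · obtain ⟨a, rfl⟩ := Nat.exists_eq_add_of_le' h
      convert mul_mem_pow_succ_mul hx (ih a b c e (by omega) (by omega) (by omega)) using 1
      ring
    · obtain ⟨b, rfl⟩ := Nat.exists_eq_add_of_le' h
      convert mul_mem_pow_succ_mul hy (ih a b c e (by omega) (by omega) (by omega)) using 1
      ring
    · obtain ⟨c, rfl⟩ := Nat.exists_eq_add_of_le' h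
      convert mul_mem_pow_succ_mul hz (ih a b c e (by omega) (by omega) (by omega)) using 1
      ring
    · obtain ⟨e, rfl⟩ := Nat.exists_eq_add_of_le' h
      convert mul_mem_pow_succ_mul ht (ih a b c e (by omega) (by omega) (by omega)) using 1
      ring

lemma mem_pow_mul_of_three (hx : x ∈ M) (hy : y ∈ M) (hz : z ∈ M) (ht : t ∈ M) (htI : t ∈ I)
    (hxy : x * y ∈ I) (hxz : x * z ∈ I) (hyz : y * z ∈ I) (r : ℕ) :
    ∀ a b c e : ℕ, 3 * r ≤ b + c + e + 2 → 3 * r ≤ a + c + e + 2 → 3 * r ≤ a + b + e + 2 →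
      x ^ a * y ^ b * z ^ c * t ^ e ∈ M ^ (2 * r - 2) * I ^ r := by
  induction r with
  | zero => simp
  | succ r ih =>
    intro a b c e h0 h1 h2
    have H (a b c e : ℕ) (h0 : 3 * r ≤ b + c + e) (h1 : 3 * r ≤ a + c + e)
        (h2 : 3 * r ≤ a + b + e) :
        x ^ a * y ^ b * z ^ c * t ^ e ∈ M ^ (2 * (r + 1) - 2) * I ^ r :=
      mem_pow_mul_of_three_aux hx hy hz ht ih 2 a b c e (by omega) (by omega) (by omega)
    have : 1 ≤ e ∨ 1 ≤ a ∧ 1 ≤ b ∧ 1 ≤ c ∧ e = 0 ∨ 1 ≤ a ∧ 1 ≤ b ∧ c = 0 ∧ e = 0 ∨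
      1 ≤ a ∧ 1 ≤ c ∧ b = 0 ∧ e = 0 ∨ 1 ≤ b ∧ 1 ≤ c ∧ a = 0 ∧ e = 0 := by omega
    rcases this with h | ⟨ha, hb, hc, rfl⟩ | ⟨h, h', rfl, rfl⟩ | ⟨h, h', rfl, rfl⟩ |
      ⟨h, h', rfl, rfl⟩
    · obtain ⟨e, rfl⟩ := Nat.exists_eq_add_of_le' h
      convert mul_mem_mul_pow_succ htI (H a b c e (by omega) (by omega) (by omega)) using 1
      ring
    · obtain ⟨a, rfl⟩ := Nat.exists_eq_add_of_le' ha
      obtain ⟨b, rfl⟩ := Nat.exists_eq_add_of_le' hb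
      obtain ⟨c, rfl⟩ := Nat.exists_eq_add_of_le' hc
      by_cases hr : r = 0
      · subst hr
        convert mul_mem_mul_pow_succ hxy (H a b (c + 1) 0 (by omega) (by omega) (by omega)) using 1
        ring
      have h3 := mul_mem_pow_succ_mul hz
        (mem_pow_mul_of_three_aux hx hy hz ht ih 1 a b c 0 (by omega) (by omega) (by omega))
      rw [show 2 * r + 1 - 2 + 1 = 2 * (r + 1) - 2 by omega] at h3
      convert mul_mem_mul_pow_succ hxy h3 using 1
      ring
    · obtain ⟨a, rfl⟩ := Nat.exists_eq_add_of_le' h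
      obtain ⟨b, rfl⟩ := Nat.exists_eq_add_of_le' h'
      convert mul_mem_mul_pow_succ hxy (H a b 0 0 (by omega) (by omega) (by omega)) using 1
      ring
    · obtain ⟨a, rfl⟩ := Nat.exists_eq_add_of_le' h
      obtain ⟨c, rfl⟩ := Nat.exists_eq_add_of_le' h'
      convert mul_mem_mul_pow_succ hxz (H a 0 c 0 (by omega) (by omega) (by omega)) using 1
      ring
    · obtain ⟨b, rfl⟩ := Nat.exists_eq_add_of_le' h
      obtain ⟨c, rfl⟩ := Nat.exists_eq_add_of_le' h'
      convert mul_mem_mul_pow_succ hyz (H 0 b c 0 (by omega) (by omega) (by omega)) using 1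
      ring

lemma mem_pow_mul_of_two_aux (hx : x ∈ M) (hz : z ∈ M) (ht : t ∈ M) {r : ℕ}
    (h : ∀ a b c e : ℕ, 3 * r ≤ b + c + e + 2 → 3 * r ≤ a + c + e + 2 →
      x ^ a * y ^ b * z ^ c * t ^ e ∈ M ^ (2 * r - 2) * I ^ r) (u : ℕ) :
    ∀ a b c e : ℕ, 3 * r + u ≤ b + c + e + 2 → 3 * r + u ≤ a + c + e + 2 →
      x ^ a * y ^ b * z ^ c * t ^ e ∈ M ^ (2 * r + u - 2) * I ^ r := by
  induction u with
  | zero => exact h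
  | succ u ih =>
    intro a b c e h0 h1
    by_cases hr : 2 * r + u < 2
    · obtain rfl : r = 0 := by omega
      rw [show 2 * 0 + (u + 1) - 2 = 0 by omega]
      simp
    rw [show 2 * r + (u + 1) - 2 = 2 * r + u - 2 + 1 by omega]
    have : 1 ≤ a ∧ 1 ≤ b ∨ 1 ≤ c ∨ 1 ≤ e := by omega
    rcases this with ⟨h, h'⟩ | h | h
    · obtain ⟨a, rfl⟩ := Nat.exists_eq_add_of_le' h
      convert mul_mem_pow_succ_mul hx (ih a b c e (by omega) (by omega)) using 1
      ring
    · obtain ⟨c, rfl⟩ := Nat.exists_eq_add_of_le' h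
      convert mul_mem_pow_succ_mul hz (ih a b c e (by omega) (by omega)) using 1
      ring
    · obtain ⟨e, rfl⟩ := Nat.exists_eq_add_of_le' h
      convert mul_mem_pow_succ_mul ht (ih a b c e (by omega) (by omega)) using 1
      ring

lemma mem_pow_mul_of_two (hx : x ∈ M) (hz : z ∈ M) (ht : t ∈ M) (htI : t ∈ I)
    (hzI : z ∈ I) (hxy : x * y ∈ I) (r : ℕ) :
    ∀ a b c e : ℕ, 3 * r ≤ b + c + e + 2 → 3 * r ≤ a + c + e + 2 →
      x ^ a * y ^ b * z ^ c * t ^ e ∈ M ^ (2 * r - 2) * I ^ r := by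
  induction r with
  | zero => simp
  | succ r ih =>
    intro a b c e h0 h1
    have H (a b c e : ℕ) (h0 : 3 * r ≤ b + c + e) (h1 : 3 * r ≤ a + c + e) :
        x ^ a * y ^ b * z ^ c * t ^ e ∈ M ^ (2 * (r + 1) - 2) * I ^ r :=
      mem_pow_mul_of_two_aux hx hz ht ih 2 a b c e (by omega) (by omega)
    have : 1 ≤ e ∨ 1 ≤ c ∨ 1 ≤ a ∧ 1 ≤ b ∧ c = 0 ∧ e = 0 := by omega
    rcases this with h | h | ⟨h, h', rfl, rfl⟩
    · obtain ⟨e, rfl⟩ := Nat.exists_eq_add_of_le' h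
      convert mul_mem_mul_pow_succ htI (H a b c e (by omega) (by omega)) using 1
      ring
    · obtain ⟨c, rfl⟩ := Nat.exists_eq_add_of_le' h
      convert mul_mem_mul_pow_succ hzI (H a b c e (by omega) (by omega)) using 1
      ring
    · obtain ⟨a, rfl⟩ := Nat.exists_eq_add_of_le' h
      obtain ⟨b, rfl⟩ := Nat.exists_eq_add_of_le' h'
      convert mul_mem_mul_pow_succ hxy (H a b 0 0 (by omega) (by omega)) using 1
      ring

end Monomials

section CoordinatePoints

variable {K : Type} [Field K] {n : ℕ}

lemma coeff_eq_zero_of_mem_pointIdeal {j : Fin 4} {F : MvPolynomial (Fin 4) K}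
    (hF : F ∈ pointIdeal K (Pi.single j 1)) {s : Fin 4 →₀ ℕ} (hs : ∀ i, i ≠ j → s i = 0) :
    coeff s F = 0 := by
  induction hF using Submodule.span_induction generalizing s with
  | mem f hf =>
    by_cases hd : s.degree = 1
    · rw [← hf.2, eval_eq', Finset.sum_eq_single s]
      · rw [Finset.prod_eq_one, mul_one]
        intro i _
        rcases eq_or_ne i j with rfl | hi
        · simp
        · simp [hs i hi]
      · intro t ht hts
        rw [mul_eq_zero]
        right
        by_contra hne
        refine hts ?_
        have ht0 (i : Fin 4) (hi : i ≠ j) : t i = 0 := by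
          by_contra h
          refine Finset.prod_ne_zero_iff.mp hne i (Finset.mem_univ i) ?_
          simp [hi, h]
        have htd : t.degree = s.degree := by
          by_contra h
          exact mem_support_iff.mp ht (hf.1.coeff_eq_zero (hd ▸ h))
        rw [Finsupp.degree_eq_sum, Finsupp.degree_eq_sum,
          Finset.sum_eq_single j (fun i _ hi => ht0 i hi) (by simp),
          Finset.sum_eq_single j (fun i _ hi => hs i hi) (by simp)] at htd
        ext i
        rcases eq_or_ne i j with rfl | hi
        · exact htd
        · rw [ht0 i hi, hs i hi]
      · intro h
        simp [notMem_support_iff.mp h]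
    · exact hf.1.coeff_eq_zero hd
  | zero => simp
  | add f g _ _ ihf ihg => rw [coeff_add, ihf hs, ihg hs, add_zero]
  | smul a f _ ih =>
    classical
    rw [smul_eq_mul, coeff_mul]
    refine Finset.sum_eq_zero fun p hp => ?_
    rw [Finset.HasAntidiagonal.mem_antidiagonal] at hp
    rw [ih fun i hi => ?_, mul_zero]
    have := hs i hi
    rw [← hp, Finsupp.add_apply] at this
    omega

lemma coeff_eq_zero_of_mem_pointIdeal_pow {j : Fin 4} {m : ℕ} {F : MvPolynomial (Fin 4) K}
    (hF : F ∈ pointIdeal K (Pi.single j 1) ^ m) {s : Fin 4 →₀ ℕ}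
    (hs : ∑ i, s i < m + s j) : coeff s F = 0 := by
  induction m generalizing F s with
  | zero =>
    have := Finset.single_le_sum (f := s) (fun i _ => Nat.zero_le _) (Finset.mem_univ j)
    omega
  | succ m ih =>
    rw [pow_succ] at hF
    induction hF using Submodule.mul_induction_on' with
    | mem_mul_mem f hf g hg =>
      classical
      rw [coeff_mul]
      refine Finset.sum_eq_zero fun p hp => ?_
      rw [Finset.HasAntidiagonal.mem_antidiagonal] at hp
      by_cases h : ∑ i, p.1 i < m + p.1 j
      · rw [ih hf h, zero_mul]
      · rw [coeff_eq_zero_of_mem_pointIdeal hg, mul_zero]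
        intro i hi
        rw [← hp] at hs
        simp only [Finsupp.add_apply, Finset.sum_add_distrib] at hs
        have := Finset.add_sum_erase Finset.univ p.2 (Finset.mem_univ j)
        have := Finset.single_le_sum (f := p.2) (fun i _ => Nat.zero_le _)
          (Finset.mem_erase.mpr ⟨hi, Finset.mem_univ i⟩)
        omega
    | add f _ g _ ihf ihg => rw [coeff_add, ihf, ihg, add_zero]

/-- The coordinate points `e₀, …, e₍ₙ₋₁₎`. -/
def coordinatePoint (K : Type) [Field K] (h : n ≤ 4) (j : Fin n) : Fin 4 → K :=
  Pi.single (Fin.castLE h j) 1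

lemma X_mem_pointIdeal {i j : Fin 4} (h : i ≠ j) : X i ∈ pointIdeal K (Pi.single j 1) :=
  Ideal.subset_span ⟨isHomogeneous_X _ _, by simp [h]⟩

lemma X_mem_iInf_pointIdeal (h : n ≤ 4) {i : Fin 4} (hi : n ≤ i.1) :
    X i ∈ ⨅ j, pointIdeal K (coordinatePoint K h j) :=
  Ideal.mem_iInf.mpr fun j => X_mem_pointIdeal fun e =>
    (j.2.trans_le hi).ne' (congrArg Fin.val e)

lemma X_mul_X_mem_iInf_pointIdeal (h : n ≤ 4) {i k : Fin 4} (hik : i ≠ k) :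
    X i * X k ∈ ⨅ j, pointIdeal K (coordinatePoint K h j) := by
  refine Ideal.mem_iInf.mpr fun j => ?_
  by_cases hi : i = Fin.castLE h j
  · exact Ideal.mul_mem_left _ _ (X_mem_pointIdeal (hi ▸ hik.symm))
  · exact Ideal.mul_mem_right _ _ (X_mem_pointIdeal hi)

/-- It suffices to treat monomials. -/
lemma mem_of_forall_monomial_mem {h : n ≤ 4} {m : ℕ} {J : Ideal (MvPolynomial (Fin 4) K)}
    (hJ : ∀ s : Fin 4 →₀ ℕ, (∀ j : Fin n, m + s (Fin.castLE h j) ≤ ∑ i, s i) →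
      X 0 ^ s 0 * X 1 ^ s 1 * X 2 ^ s 2 * X 3 ^ s 3 ∈ J) :
    ⨅ j, pointIdeal K (coordinatePoint K h j) ^ m ≤ J := by
  intro F hF
  rw [F.as_sum]
  refine Ideal.sum_mem _ fun s hs => ?_
  rw [monomial_eq, Finsupp.prod_fintype _ _ fun _ => pow_zero _, Fin.prod_univ_four]
  refine J.mul_mem_left _ (hJ s fun j => ?_)
  by_contra hlt
  exact mem_support_iff.mp hs
    (coeff_eq_zero_of_mem_pointIdeal_pow ((Ideal.mem_iInf.mp hF) j) (not_le.mp hlt))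

lemma containment_coordinatePoint (h : n ≤ 4) (h2 : 2 ≤ n) (h3 : n ≤ 3) {r : ℕ} (hr : 1 ≤ r) :
    ⨅ j, pointIdeal K (coordinatePoint K h j) ^ (3 * r - 2) ≤
      irrIdeal K ^ (2 * r - 2) * (⨅ j, pointIdeal K (coordinatePoint K h j)) ^ r := by
  have hX (i : Fin 4) : (X i : MvPolynomial (Fin 4) K) ∈ irrIdeal K := Ideal.subset_span ⟨i, rfl⟩
  obtain rfl | rfl : n = 2 ∨ n = 3 := by omega
  · refine mem_of_forall_monomial_mem fun s hs => ?_
    have hs0 : 3 * r - 2 + s 0 ≤ ∑ i, s i := hs 0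
    have hs1 : 3 * r - 2 + s 1 ≤ ∑ i, s i := hs 1
    rw [Fin.sum_univ_four] at hs0 hs1
    exact mem_pow_mul_of_two (hX 0) (hX 2) (hX 3) (X_mem_iInf_pointIdeal h (by simp))
      (X_mem_iInf_pointIdeal h (by simp)) (X_mul_X_mem_iInf_pointIdeal h (by simp))
      r _ _ _ _ (by omega) (by omega)
  · refine mem_of_forall_monomial_mem fun s hs => ?_
    have hs0 : 3 * r - 2 + s 0 ≤ ∑ i, s i := hs 0
    have hs1 : 3 * r - 2 + s 1 ≤ ∑ i, s i := hs 1
    have hs2 : 3 * r - 2 + s 2 ≤ ∑ i, s i := hs 2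
    rw [Fin.sum_univ_four] at hs0 hs1 hs2
    exact mem_pow_mul_of_three (hX 0) (hX 1) (hX 2) (hX 3) (X_mem_iInf_pointIdeal h (by simp))
      (X_mul_X_mem_iInf_pointIdeal h (by simp)) (X_mul_X_mem_iInf_pointIdeal h (by simp))
      (X_mul_X_mem_iInf_pointIdeal h (by simp)) r _ _ _ _ (by omega) (by omega) (by omega)

end CoordinatePoints

section LinearChange

variable {K : Type} [Field K] {n : ℕ}

/-- The substitution of the linear forms with coefficient matrix `L` for the variables. -/
def linearChange (L : Matrix (Fin 4) (Fin 4) K) :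
    MvPolynomial (Fin 4) K →ₐ[K] MvPolynomial (Fin 4) K :=
  aeval fun i => ∑ k, C (L i k) * X k

lemma eval_linearChange (L : Matrix (Fin 4) (Fin 4) K) (u : Fin 4 → K)
    (F : MvPolynomial (Fin 4) K) : eval u (linearChange L F) = eval (L.mulVec u) F := by
  have : (eval u).comp (linearChange L).toRingHom = eval (L.mulVec u) := by
    ext i
    · simp
    · simp [linearChange, Matrix.mulVec, dotProduct]
  exact DFunLike.congr_fun this F

lemma linearChange_isHomogeneous (L : Matrix (Fin 4) (Fin 4) K) {F : MvPolynomial (Fin 4) K}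
    {d : ℕ} (hF : F.IsHomogeneous d) : (linearChange L F).IsHomogeneous d := by
  have := hF.aeval (fun i => ∑ k, C (L i k) * X k) fun i =>
    IsHomogeneous.sum _ _ 1 fun k _ => isHomogeneous_C_mul_X _ _
  rwa [one_mul] at this

lemma linearChange_linearChange {L N : Matrix (Fin 4) (Fin 4) K} (h : L * N = 1)
    (F : MvPolynomial (Fin 4) K) : linearChange N (linearChange L F) = F := by
  have : (linearChange N).comp (linearChange L) = AlgHom.id K _ := by
    ext i : 1
    simp only [linearChange, AlgHom.comp_apply, aeval_X, map_sum, map_mul, algHom_C,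
      algebraMap_eq, AlgHom.id_apply, Finset.mul_sum]
    rw [Finset.sum_comm]
    simp_rw [← mul_assoc, ← Finset.sum_mul, ← map_mul, ← map_sum, ← Matrix.mul_apply, h]
    rw [Finset.sum_eq_single i]
    · simp
    · intro k _ hk
      simp [Matrix.one_apply_ne hk.symm]
    · simp
  exact DFunLike.congr_fun this F

lemma map_linearChange_pointIdeal_le (L : Matrix (Fin 4) (Fin 4) K) (u : Fin 4 → K) :
    (pointIdeal K (L.mulVec u)).map (linearChange L) ≤ pointIdeal K u := by
  rw [pointIdeal, Ideal.map_span, Ideal.span_le]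
  rintro _ ⟨f, hf, rfl⟩
  exact Ideal.subset_span ⟨linearChange_isHomogeneous L hf.1, by
    rw [← hf.2]; exact eval_linearChange L u f⟩

lemma map_linearChange_irrIdeal_le (L : Matrix (Fin 4) (Fin 4) K) :
    (irrIdeal K).map (linearChange L) ≤ irrIdeal K := by
  rw [irrIdeal, Ideal.map_span, Ideal.span_le]
  rintro _ ⟨_, ⟨i, rfl⟩, rfl⟩
  show linearChange L (X i) ∈ irrIdeal K
  rw [linearChange, aeval_X]
  exact Ideal.sum_mem _ fun k _ => Ideal.mul_mem_left _ _ (Ideal.subset_span ⟨k, rfl⟩)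

lemma containment_of_mulVec {v e : Fin n → Fin 4 → K} {L N : Matrix (Fin 4) (Fin 4) K}
    (hLN : L * N = 1) (hv : ∀ j, L.mulVec (e j) = v j) {m a r : ℕ}
    (h : ⨅ j, pointIdeal K (e j) ^ m ≤ irrIdeal K ^ a * (⨅ j, pointIdeal K (e j)) ^ r) :
    ⨅ j, pointIdeal K (v j) ^ m ≤ irrIdeal K ^ a * (⨅ j, pointIdeal K (v j)) ^ r := by
  intro F hF
  have he (j : Fin n) : N.mulVec (v j) = e j := by
    rw [← hv, Matrix.mulVec_mulVec, mul_eq_one_comm.mp hLN, Matrix.one_mulVec]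
  have h1 : linearChange L F ∈ ⨅ j, pointIdeal K (e j) ^ m := by
    refine Ideal.mem_iInf.mpr fun j => ?_
    have h2 := Ideal.mem_map_of_mem (linearChange L) ((Ideal.mem_iInf.mp hF) j)
    rw [Ideal.map_pow, ← hv j] at h2
    exact Ideal.pow_right_mono (map_linearChange_pointIdeal_le L (e j)) m h2
  have h3 := Ideal.mem_map_of_mem (linearChange N) (h h1)
  rw [linearChange_linearChange hLN, Ideal.map_mul, Ideal.map_pow, Ideal.map_pow] at h3
  refine Ideal.mul_mono (Ideal.pow_right_mono (map_linearChange_irrIdeal_le N) a)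
    (Ideal.pow_right_mono (le_iInf fun j => ?_) r) h3
  refine (Ideal.map_mono (iInf_le _ j)).trans ?_
  rw [← he j]
  exact map_linearChange_pointIdeal_le N (v j)

/-- The matrix whose first `n` columns are the given vectors, completed by an identity block. -/
def frameMatrix (K : Type) [Field K] (n : ℕ) :
    Matrix (Fin 4) (Fin 4) (MvPolynomial (Fin n × Fin 4) K) :=
  fun i k => if h : k.1 < n then X (⟨k.1, h⟩, i) else C ((1 : Matrix (Fin 4) (Fin 4) K) i k)

lemma generic_frame (h : n ≤ 4) : Generic fun v : Fin n → Fin 4 → K =>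
    ∃ L N : Matrix (Fin 4) (Fin 4) K, L * N = 1 ∧
      ∀ j, L.mulVec (coordinatePoint K h j) = v j := by
  have h1 : specMatrix (frameMatrix K n) (coordinatePoint K h) = 1 := by
    ext i k
    by_cases hk : k.1 < n
    · simp [specMatrix, frameMatrix, hk, coordinatePoint, Matrix.one_apply, Pi.single_apply]
    · simp [specMatrix, frameMatrix, hk]
  refine (generic_of_eval_ne_zero (frameMatrix K n).det (v₀ := coordinatePoint K h) ?_).mono
    fun v hv => ?_
  · rw [eval_det_eq, h1, Matrix.det_one]
    exact one_ne_zero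
  · rw [eval_det_eq] at hv
    refine ⟨specMatrix (frameMatrix K n) v, _, Matrix.mul_nonsing_inv _ (isUnit_iff_ne_zero.mpr hv),
      fun j => ?_⟩
    ext i
    simp [coordinatePoint, specMatrix, frameMatrix]

lemma generic_containment_two_three (h2 : 2 ≤ n) (h3 : n ≤ 3) {r : ℕ} (hr : 1 ≤ r) :
    Generic fun v : Fin n → Fin 4 → K => ⨅ j, pointIdeal K (v j) ^ (3 * r - 2) ≤
      irrIdeal K ^ (2 * r - 2) * (⨅ j, pointIdeal K (v j)) ^ r :=
  (generic_frame (h3.trans (by norm_num))).mono fun _ ⟨_, _, hLN, hv⟩ =>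
    containment_of_mulVec hLN hv (containment_coordinatePoint _ h2 h3 hr)

end LinearChange

section Numerics

variable {K : Type} [Field K] {n : ℕ}

lemma six_mul_choose_three (m : ℕ) : 6 * (m + 2).choose 3 = (m + 2) * (m + 1) * m := by
  have := Nat.descFactorial_eq_factorial_mul_choose (m + 2) 3
  simp only [Nat.descFactorial_succ, Nat.descFactorial_zero, Nat.factorial] at this
  rw [show m + 2 - 2 = m by omega, show m + 2 - 1 = m + 1 by omega] at this
  norm_num at this
  linarith

lemma bounded_of_choose_lt [CharZero K] {d r : ℕ} (hr : 2 ≤ r) (hd : 10 ≤ d)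
    (h : (d + 2).choose 3 < n) : Bounded K n (d + 1) r := by
  have h6 := six_mul_choose_three d
  obtain ⟨b, rfl | rfl⟩ := Nat.even_or_odd' d
  · refine (bounded_cube (a := b + 1) hr b.succ_pos (by omega)).mono ?_
    obtain ⟨c, rfl⟩ := Nat.exists_eq_add_of_le' (show 5 ≤ b by omega)
    nlinarith [sq_nonneg c]
  · by_cases hb : b < 9
    · obtain rfl | rfl | rfl | rfl : b = 5 ∨ b = 6 ∨ b = 7 ∨ b = 8 := by omega
      · exact (bounded_280 hr).mono (by omega)
      · exact (bounded_439 hr).mono (by omega)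
      · exact (bounded_629 hr).mono (by omega)
      · exact (bounded_869 hr).mono (by omega)
    · refine (bounded_cube (a := b + 2) hr (by omega) (by omega)).mono ?_
      obtain ⟨c, rfl⟩ := Nat.exists_eq_add_of_le' (show 9 ≤ b by omega)
      nlinarith [sq_nonneg c]

lemma exists_choose_lt_le (h : 221 ≤ n) :
    ∃ d, 10 ≤ d ∧ (d + 2).choose 3 < n ∧ n ≤ (d + 3).choose 3 := by
  have hex : ∃ d, n ≤ (d + 3).choose 3 := by
    refine ⟨n, ?_⟩
    have : 6 * (n + 3).choose 3 = (n + 3) * (n + 2) * (n + 1) := six_mul_choose_three (n + 1)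
    have : 6 * (n + 1) ≤ (n + 3) * (n + 2) * (n + 1) := Nat.mul_le_mul_right _ (by nlinarith)
    omega
  have hspec := Nat.find_spec hex
  have h10 : 10 ≤ Nat.find hex := by
    by_contra hlt
    have := Nat.choose_le_choose 3 (show Nat.find hex + 3 ≤ 12 by omega)
    have : Nat.choose 12 3 = 220 := by decide
    omega
  refine ⟨Nat.find hex, h10, ?_, hspec⟩
  have := Nat.find_min hex (show Nat.find hex - 1 < Nat.find hex by omega)
  rwa [not_le, show Nat.find hex - 1 + 3 = Nat.find hex + 2 by omega] at this

end Numerics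

section Containment

variable {K : Type} [Field K] {n : ℕ}

/-- The containment of the theorem, at given points. -/
def Contained (r : ℕ) (v : Fin n → Fin 4 → K) : Prop :=
  ⨅ j, pointIdeal K (v j) ^ (3 * r - 2) ≤
    irrIdeal K ^ (2 * r - 2) * (⨅ j, pointIdeal K (v j)) ^ r

variable [CharZero K]

lemma Bounded.generic_contained {d r : ℕ} (h : Bounded K n (d + 1) r) (hr : 1 ≤ r)
    (hn : n ≤ (d + 3).choose 3) : Generic (Contained (K := K) (n := n) r) := by
  obtain ⟨l, hl, hno⟩ := h
  exact (generic_zero_ne_zero.and ((generic_separated hn).and (generic_noForm hl hno))).mono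
    fun _ ⟨hv, hQ, h⟩ => containment_of_noForm hr hv hQ h

lemma Bounded.generic_contained_of_decomposes {d r : ℕ} (h : Bounded K n d r) (hr : 2 ≤ r)
    (hd : Generic fun v : Fin n → Fin 4 → K => Decomposes v d) :
    Generic (Contained (K := K) (n := n) r) := by
  obtain ⟨l, hl, hno⟩ := h
  exact (generic_zero_ne_zero.and (hd.and (generic_noForm hl hno))).mono fun _ ⟨hv, hQ, h⟩ =>
    containment_of_noForm_of_generated hr hv hQ.separated (hQ.formsIdeal_le hv) h

lemma generic_contained {r : ℕ} (hn : 1 ≤ n) (hr : 2 ≤ r) :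
    Generic (Contained (K := K) (n := n) r) := by
  have hr1 : 1 ≤ r := by omega
  by_cases h1 : n ≤ 1
  · exact ((bounded_one hr).mono hn).generic_contained hr1 h1
  by_cases h3 : n ≤ 3
  · exact generic_containment_two_three (by omega) h3 hr1
  by_cases h6 : n ≤ 6
  · exact ((bounded_four hr).mono (by omega)).generic_contained_of_decomposes hr
      (generic_decomposes_two h6)
  by_cases h14 : n ≤ 14
  · have : Bounded K 7 3 r := by
      obtain rfl | h : r = 2 ∨ 3 ≤ r := by omega
      exacts [bounded_seven_two, bounded_seven h]
    exact (this.mono (by omega)).generic_contained_of_decomposes hr (generic_decomposes_three h14)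
  by_cases h26 : n ≤ 26
  · have : Bounded K 15 4 r := by
      obtain rfl | h : r = 2 ∨ 3 ≤ r := by omega
      exacts [bounded_fifteen_two, bounded_fifteen h]
    exact (this.mono (by omega)).generic_contained_of_decomposes hr (generic_decomposes_four h26)
  by_cases h44 : n ≤ 44
  · exact ((bounded_cube (a := 3) hr (by norm_num) (by norm_num)).mono
      (by omega)).generic_contained_of_decomposes hr (generic_decomposes_five h44)
  by_cases h63 : n ≤ 63
  · exact ((bounded_fortyFive hr).mono (by omega)).generic_contained_of_decomposes hr
      (generic_decomposes_six h63)
  by_cases h90 : n ≤ 90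
  · exact ((bounded_cube (a := 4) hr (by norm_num) (by norm_num)).mono
      (by omega)).generic_contained_of_decomposes hr (generic_decomposes_seven h90)
  by_cases h120 : n ≤ 120
  · exact ((bounded_ninetyOne hr).mono (by omega)).generic_contained (d := 7) hr1 h120
  by_cases h165 : n ≤ 165
  · exact ((bounded_116 hr).mono (by omega)).generic_contained (d := 8) hr1 h165
  by_cases h220 : n ≤ 220
  · exact ((bounded_163 hr).mono (by omega)).generic_contained (d := 9) hr1 h220
  obtain ⟨d, hd, hlt, hle⟩ := exists_choose_lt_le (n := n) (by omega)
  exact (bounded_of_choose_lt hr hd hlt).generic_contained hr1 hle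

end Containment

theorem containment_3r_sub_2 (K : Type) [Field K] [CharZero K] (n r : ℕ)
    (hn : 1 ≤ n) (hr : 1 ≤ r) :
    ∃ G : MvPolynomial (Fin n × Fin 4) K, G ≠ 0 ∧
      ∀ v : Fin n → Fin 4 → K, (∀ j, v j ≠ 0) →
        eval (fun p => v p.1 p.2) G ≠ 0 →
        (⨅ j, pointIdeal K (v j) ^ (3 * r - 2)) ≤
          irrIdeal K ^ (2 * r - 2) * (⨅ j, pointIdeal K (v j)) ^ r := by
  obtain rfl | hr : r = 1 ∨ 2 ≤ r := by omega
  · exact ⟨1, one_ne_zero, fun v _ _ => by simp⟩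
  · obtain ⟨G, h0, hG⟩ := generic_contained (K := K) hn hr
    exact ⟨G, h0, fun v _ hv => hG v hv⟩

end
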